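/- arXiv:1703.00606 — 6 statements merged into one kernel-verified Lean document; each statement's English description precedes it below -/
import Mathlib

section
/- Let G be a connected graph that is (P2 ∪ P3)-free, diamond-free and K4-free, and suppose G contains a triangle T that is non-dominating (some vertex of G outside T has no neighbor in T). Then G is 4-colorable. -/
open SimpleGraph

/-- The disjoint union `P2 ∪ P3`, on 5 vertices: edges 01, 23, 34. -/
def p2p3 : SimpleGraph (Fin 5) :=
  SimpleGraph.fromEdgeSet {s(0, 1), s(2, 3), s(3, 4)}

/-- The diamond: `K4` minus the edge 02. -/
def diamond : SimpleGraph (Fin 4) :=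
  SimpleGraph.fromEdgeSet {s(0, 1), s(1, 2), s(2, 3), s(0, 3), s(1, 3)}

/-- The bull: vertices v1,...,v5 are 0,...,4; edges v1v2, v2v3, v3v4, v2v5, v3v5. -/
def bull : SimpleGraph (Fin 5) :=
  SimpleGraph.fromEdgeSet {s(0, 1), s(1, 2), s(2, 3), s(1, 4), s(2, 4)}

/-- `K4`, the complete graph on 4 vertices. -/
def K4 : SimpleGraph (Fin 4) := ⊤

/-- `G` contains no induced subgraph isomorphic to `H`
(graph embeddings are exactly induced copies). -/
def IndFree {α β : Type*} (H : SimpleGraph α) (G : SimpleGraph β) : Prop :=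
  ¬ Nonempty (H ↪g G)

/-- `G` is `P2 ∪ P3`-free and every edge lies in at most one triangle. -/
structure ThinP2P3Free {V : Type*} (G : SimpleGraph V) : Prop where
  tri : ∀ u v p q, G.Adj u v → G.Adj p u → G.Adj p v → G.Adj q u → G.Adj q v → p = q
  path : ∀ p q r s t, G.Adj p q → G.Adj r s → G.Adj s t → r ≠ t → ¬ G.Adj r t →
    G.Adj p r ∨ G.Adj p s ∨ G.Adj p t ∨ G.Adj q r ∨ G.Adj q s ∨ G.Adj q t

theorem ThinP2P3Free.of_indFree {V : Type*} {G : SimpleGraph V} (hP : IndFree p2p3 G)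
    (hD : IndFree diamond G) (hK : IndFree K4 G) : ThinP2P3Free G where
  tri := by
    intro u v p q huv hpu hpv hqu hqv
    by_contra hpq
    have n1 := huv.ne
    have n2 := hpu.ne
    have n3 := hpv.ne
    have n4 := hqu.ne
    have n5 := hqv.ne
    have hinj : Function.Injective ![p, u, q, v] := by
      intro i j h
      fin_cases i <;> fin_cases j <;> simp_all
    by_cases h : G.Adj p q
    · refine hK ⟨⟨⟨![p, u, q, v], hinj⟩, ?_⟩⟩
      intro i j
      fin_cases i <;> fin_cases j <;> simp [K4, *, G.adj_comm, hpu.symm, hpv.symm,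
        hqu.symm, hqv.symm]
    · have h' : ¬ G.Adj q p := fun e => h e.symm
      refine hD ⟨⟨⟨![p, u, q, v], hinj⟩, ?_⟩⟩
      intro i j
      fin_cases i <;> fin_cases j <;> simp [diamond, *, huv.symm, hpu.symm, hpv.symm,
        hqu.symm, hqv.symm]
  path := by
    intro p q r s t hpq hrs hst hrt nrt
    by_contra! hno
    obtain ⟨h1, h2, h3, h4, h5, h6⟩ := hno
    have hinj : Function.Injective ![p, q, r, s, t] := by
      have e1 : p ≠ r := by rintro rfl; exact h2 hrs
      have e2 : p ≠ s := by rintro rfl; exact h1 hrs.symm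
      have e3 : p ≠ t := by rintro rfl; exact h2 hst.symm
      have e4 : q ≠ r := by rintro rfl; exact h5 hrs
      have e5 : q ≠ s := by rintro rfl; exact h4 hrs.symm
      have e6 : q ≠ t := by rintro rfl; exact h5 hst.symm
      have e7 := hpq.ne
      have e8 := hrs.ne
      have e9 := hst.ne
      intro i j h
      fin_cases i <;> fin_cases j <;> simp_all
    refine hP ⟨⟨⟨![p, q, r, s, t], hinj⟩, ?_⟩⟩
    have k1 : ¬ G.Adj r p := fun e => h1 e.symm
    have k2 : ¬ G.Adj s p := fun e => h2 e.symm
    have k3 : ¬ G.Adj t p := fun e => h3 e.symm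
    have k4 : ¬ G.Adj r q := fun e => h4 e.symm
    have k5 : ¬ G.Adj s q := fun e => h5 e.symm
    have k6 : ¬ G.Adj t q := fun e => h6 e.symm
    have k7 : ¬ G.Adj t r := fun e => nrt e.symm
    intro i j
    fin_cases i <;> fin_cases j <;> simp [p2p3, *, hpq.symm, hrs.symm, hst.symm]

/-- A set in which every vertex has at most one neighbour can be properly 2-coloured. -/
theorem exists_bool_coloring {V : Type*} (G : SimpleGraph V) (S : V → Prop)
    (h : ∀ u v w, S u → S v → S w → G.Adj u v → G.Adj u w → v = w) :
    ∃ g : V → Bool, ∀ u v, S u → S v → G.Adj u v → g u ≠ g v := by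
  classical
  let r : V → V → Prop := WellOrderingRel
  have key : ∀ u v, S u → S v → G.Adj u v → r u v →
      (∃ w, S w ∧ G.Adj u w ∧ r u w) ∧ ¬ ∃ w, S w ∧ G.Adj v w ∧ r v w := by
    intro u v hu hv huv hr
    refine ⟨⟨v, hv, huv, hr⟩, ?_⟩
    rintro ⟨w, hw, hvw, hr'⟩
    obtain rfl := h v u w hv hu hw huv.symm hvw
    exact asymm_of WellOrderingRel hr hr'
  refine ⟨fun u => decide (∃ w, S w ∧ G.Adj u w ∧ r u w), fun u v hu hv huv => ?_⟩
  rcases trichotomous_of WellOrderingRel u v with hr | hr | hr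
  · have := key u v hu hv huv hr
    simp [this.1, this.2]
  · exact absurd hr huv.ne
  · have := key v u hv hu huv.symm hr
    simp [this.1, this.2]

/-- The vertices whose only neighbour in the triangle `T` is `T i`. -/
def Priv {V : Type*} (G : SimpleGraph V) (T : Fin 3 → V) (i : Fin 3) (v : V) : Prop :=
  ∀ j, G.Adj v (T j) ↔ j = i

/-- The vertices without neighbours in `T`. -/
def Far {V : Type*} (G : SimpleGraph V) (T : Fin 3 → V) (v : V) : Prop :=
  ∀ j, ¬ G.Adj v (T j)

section
variable {V : Type*} {G : SimpleGraph V} {T : Fin 3 → V}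

theorem Priv.not_far {i : Fin 3} {v : V} (h : Priv G T i v) : ¬ Far G T v :=
  fun hf => hf i ((h i).2 rfl)

theorem Priv.index_unique {i j : Fin 3} {v : V} (h : Priv G T i v) (h' : Priv G T j v) : i = j :=
  (h' i).1 ((h i).2 rfl)

theorem exists_ne_ne_fin_three (i j : Fin 3) : ∃ k, k ≠ i ∧ k ≠ j := by
  revert i j; decide

theorem eq_or_eq_or_eq_fin_three {i j k : Fin 3} (hij : i ≠ j) (hik : i ≠ k) (hjk : j ≠ k)
    (l : Fin 3) : l = i ∨ l = j ∨ l = k := by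
  revert i j k l; decide

/-- An injective colouring of `Fin 3` giving `i` colour `2` and `j` colour `0`. -/
def triColor (i j l : Fin 3) : Fin 4 := if l = i then 2 else if l = j then 0 else 1

theorem triColor_injective {i j : Fin 3} (hij : i ≠ j) : Function.Injective (triColor i j) := by
  have : ∀ i j, i ≠ j → ∀ l m, triColor i j l = triColor i j m → l = m := by decide
  exact fun l m => this i j hij l m

theorem triColor_self (i j : Fin 3) : triColor i j i = 2 := by simp [triColor]

theorem triColor_of_ne {i l : Fin 3} (j : Fin 3) (h : l ≠ i) :
    triColor i j l = 0 ∨ triColor i j l = 1 := by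
  rw [triColor, if_neg h]
  split_ifs <;> simp

theorem Far.ne {v : V} (hT : ∀ i j, i ≠ j → G.Adj (T i) (T j)) (hv : Far G T v) (i : Fin 3) :
    v ≠ T i := by
  rintro rfl
  obtain ⟨j, hj, -⟩ := exists_ne_ne_fin_three i i
  exact hv j (hT i j hj.symm)

theorem Priv.ne {v : V} {i : Fin 3} (hT : ∀ i j, i ≠ j → G.Adj (T i) (T j)) (hv : Priv G T i v)
    (j : Fin 3) : v ≠ T j := by
  rintro rfl
  obtain ⟨l, h1, h2⟩ := exists_ne_ne_fin_three i j
  exact h1 ((hv l).1 (hT j l h2.symm))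

theorem eq_or_far_or_priv (hG : ThinP2P3Free G) (hT : ∀ i j, i ≠ j → G.Adj (T i) (T j)) (v : V) :
    (∃ i, v = T i) ∨ Far G T v ∨ ∃ i, Priv G T i v := by
  by_cases hv : ∃ i, v = T i
  · exact Or.inl hv
  by_cases hf : Far G T v
  · exact Or.inr (Or.inl hf)
  refine Or.inr (Or.inr ?_)
  simp only [Far, not_forall, not_not] at hf
  obtain ⟨i, hi⟩ := hf
  refine ⟨i, fun j => ⟨fun hj => ?_, fun h => h ▸ hi⟩⟩
  by_contra hji
  obtain ⟨k, hk1, hk2⟩ := exists_ne_ne_fin_three i j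
  exact hv ⟨k, hG.tri (T i) (T j) v (T k) (hT i j (Ne.symm hji)) hi hj (hT k i hk1) (hT k j hk2)⟩

/-- A colouring of the rest of the graph that is compatible with an injective colouring of the
triangle extends to the whole graph. -/
theorem colorable_of_off_triangle (hG : ThinP2P3Free G) (hT : ∀ i j, i ≠ j → G.Adj (T i) (T j))
    (t : Fin 3 → Fin 4) (ht : Function.Injective t) (g : V → Fin 4)
    (hg : ∀ i u, Priv G T i u → g u ≠ t i)
    (hgg : ∀ u v, (Far G T u ∨ ∃ i, Priv G T i u) → (Far G T v ∨ ∃ i, Priv G T i v) →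
      G.Adj u v → g u ≠ g v) :
    G.Colorable 4 := by
  classical
  have hinj : Function.Injective T := by
    intro i j h
    by_contra hij
    exact (hT i j hij).ne h
  let f : V → Fin 4 := fun v => if h : ∃ i, v = T i then t h.choose else g v
  have fT : ∀ i, f (T i) = t i := by
    intro i
    have h : ∃ j, T i = T j := ⟨i, rfl⟩
    simp only [f, dif_pos h]
    rw [← hinj h.choose_spec]
  have fO : ∀ v, (Far G T v ∨ ∃ i, Priv G T i v) → f v = g v := by
    intro v hv
    have : ¬ ∃ i, v = T i := by
      rintro ⟨i, hi⟩
      rcases hv with hv | ⟨j, hv⟩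
      · exact hv.ne hT i hi
      · exact hv.ne hT i hi
    simp only [f, dif_neg this]
  have half : ∀ u v, G.Adj u v → (∃ i, v = T i) → f u ≠ f v := by
    rintro u v huv ⟨j, rfl⟩
    rw [fT]
    rcases eq_or_far_or_priv hG hT u with ⟨i, rfl⟩ | hu | ⟨i, hu⟩
    · rw [fT]
      exact fun e => huv.ne (by rw [ht e])
    · exact (hu j huv).elim
    · obtain rfl := (hu j).1 huv
      rw [fO u (Or.inr ⟨_, hu⟩)]
      exact hg _ u hu
  refine ⟨Coloring.mk f fun {u v} huv => ?_⟩
  rcases eq_or_far_or_priv hG hT u with hu | hu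
  · exact (half v u huv.symm hu).symm
  rcases eq_or_far_or_priv hG hT v with hv | hv
  · exact half u v huv hv
  rw [fO u hu, fO v hv]
  exact hgg u v hu hv huv

/-- If `p q` is an edge without neighbours in `T` other than `T i`, every vertex attached to
another vertex of `T` is adjacent to `p` or `q`. -/
theorem adj_or_adj_of_edge (hG : ThinP2P3Free G) (hT : ∀ i j, i ≠ j → G.Adj (T i) (T j))
    {i j : Fin 3} (hij : i ≠ j) {p q y : V} (hp : ∀ l, l ≠ i → ¬ G.Adj p (T l))
    (hq : ∀ l, l ≠ i → ¬ G.Adj q (T l)) (hpq : G.Adj p q) (hy : Priv G T j y) :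
    G.Adj y p ∨ G.Adj y q := by
  obtain ⟨k, hki, hkj⟩ := exists_ne_ne_fin_three i j
  have := hG.path p q y (T j) (T k) hpq ((hy j).2 rfl) (hT j k hkj.symm) (hy.ne hT k)
    (fun h => hkj ((hy k).1 h))
  have h1 := hp j hij.symm
  have h2 := hp k hki
  have h3 := hq j hij.symm
  have h4 := hq k hki
  have := G.adj_comm y p
  have := G.adj_comm y q
  tauto

theorem Priv.not_adj {i : Fin 3} {v : V} (h : Priv G T i v) (l : Fin 3) (hl : l ≠ i) :
    ¬ G.Adj v (T l) :=
  fun e => hl ((h l).1 e)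

/-- Neighbourhoods induce matchings. -/
theorem ThinP2P3Free.matching (hG : ThinP2P3Free G) (S : V → Prop) (x : V)
    (hS : ∀ u, S u → G.Adj u x) :
    ∃ g : V → Bool, ∀ u v, S u → S v → G.Adj u v → g u ≠ g v :=
  exists_bool_coloring G S fun u v w hu hv hw huv huw =>
    hG.tri u x v w (hS u hu) huv.symm (hS v hv) huw.symm (hS w hw)

/-- A path from a vertex of class `i` through a far vertex to a vertex of class `i` closes up to a
triangle, and similarly for the other paths avoiding two vertices of `T`. -/
theorem adj_of_path (hG : ThinP2P3Free G) (hT : ∀ i j, i ≠ j → G.Adj (T i) (T j))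
    (i : Fin 3) {r s t : V} (hr : ∀ l, l ≠ i → ¬ G.Adj r (T l))
    (hs : ∀ l, l ≠ i → ¬ G.Adj s (T l)) (ht : ∀ l, l ≠ i → ¬ G.Adj t (T l))
    (hrs : G.Adj r s) (hst : G.Adj s t) (hrt : r ≠ t) : G.Adj r t := by
  by_contra h
  obtain ⟨j, hj, -⟩ := exists_ne_ne_fin_three i i
  obtain ⟨k, hk, hkj⟩ := exists_ne_ne_fin_three i j
  have := hG.path (T j) (T k) r s t (hT j k hkj.symm) hrs hst hrt h
  simp only [G.adj_comm (T _), hr j hj, hr k hk, hs j hj, hs k hk, ht j hj, ht k hk] at this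
  simp at this

/-- A non-dominating triangle whose far vertices are independent and have at most one neighbour
attached to each vertex of the triangle. -/
structure SparseFar (G : SimpleGraph V) (T : Fin 3 → V) : Prop where
  thin : ThinP2P3Free G
  tri : ∀ i j, i ≠ j → G.Adj (T i) (T j)
  indep : ∀ u v, Far G T u → Far G T v → ¬ G.Adj u v
  unique : ∀ d i p q, Far G T d → Priv G T i p → Priv G T i q → G.Adj d p → G.Adj d q → p = q

namespace SparseFar

/-- Far vertices have degree at most three, so it suffices to colour the others. -/
theorem colorable_of_near (H : SparseFar G T) (t : Fin 3 → Fin 4) (ht : Function.Injective t)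
    (g : V → Fin 4) (hg : ∀ i u, Priv G T i u → g u ≠ t i)
    (hgg : ∀ i j u v, Priv G T i u → Priv G T j v → G.Adj u v → g u ≠ g v) :
    G.Colorable 4 := by
  classical
  have hchoice : ∀ d, ∃ k : Fin 4, Far G T d → ∀ i u, Priv G T i u → G.Adj d u → k ≠ g u := by
    intro d
    have hc : ∀ i, ∃ m : Fin 4, ∀ u, Far G T d → Priv G T i u → G.Adj d u → g u = m := by
      intro i
      by_cases h : ∃ u, Priv G T i u ∧ G.Adj d u
      · obtain ⟨u, hu, hdu⟩ := h
        exact ⟨g u, fun w hd hw hdw => by rw [H.unique d i w u hd hw hu hdw hdu]⟩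
      · exact ⟨0, fun u _ hu hdu => (h ⟨u, hu, hdu⟩).elim⟩
    choose m hm using hc
    obtain ⟨k, hk⟩ : ∃ k : Fin 4, ∀ i, k ≠ m i := by
      clear hm; revert m; decide
    exact ⟨k, fun hd i u hu hdu => by rw [hm i u hd hu hdu]; exact hk i⟩
  choose k hk using hchoice
  refine colorable_of_off_triangle H.thin H.tri t ht (fun v => if Far G T v then k v else g v)
    (fun i u hu => by simpa only [if_neg hu.not_far] using hg i u hu) fun u v hu hv huv => ?_
  rcases hu with hu | ⟨i, hu⟩ <;> rcases hv with hv | ⟨j, hv⟩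
  · exact (H.indep u v hu hv huv).elim
  · simp only [if_pos hu, if_neg hv.not_far]
    exact hk u hu j v hv huv
  · simp only [if_neg hu.not_far, if_pos hv]
    exact (hk v hv i u hu huv.symm).symm
  · simp only [if_neg hu.not_far, if_neg hv.not_far]
    exact hgg i j u v hu hv huv

/-- It suffices to 2-colour the union of two of the three classes. -/
theorem colorable_of_bool (H : SparseFar G T) {i j k : Fin 3} (hij : i ≠ j) (hik : i ≠ k)
    (hjk : j ≠ k) (β : V → Bool)
    (hβ : ∀ u v, Priv G T j u ∨ Priv G T k u → Priv G T j v ∨ Priv G T k v →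
      G.Adj u v → β u ≠ β v) : G.Colorable 4 := by
  classical
  obtain ⟨α, hα⟩ := H.thin.matching (Priv G T i) (T i) fun u hu => (hu i).2 rfl
  have other : ∀ l u, l ≠ i → Priv G T l u → ¬ Priv G T i u ∧ (Priv G T j u ∨ Priv G T k u) := by
    intro l u hl hu
    refine ⟨fun h => hl (hu.index_unique h), ?_⟩
    rcases eq_or_eq_or_eq_fin_three hij hik hjk l with rfl | rfl | rfl
    · exact (hl rfl).elim
    · exact Or.inl hu
    · exact Or.inr hu
  let c : Bool → Fin 4 := fun b => if b then 0 else 1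
  let c' : Bool → Fin 4 := fun b => if b then 2 else 3
  have hcc : ∀ a b, c a ≠ c' b := by decide
  have hc : ∀ a b, a ≠ b → c a ≠ c b := by decide
  have hc' : ∀ a b, a ≠ b → c' a ≠ c' b := by decide
  have hc2 : ∀ a, c a ≠ 2 := by decide
  have hc0 : ∀ a, c' a ≠ 0 ∧ c' a ≠ 1 := by decide
  refine H.colorable_of_near (triColor i j) (triColor_injective hij)
    (fun u => if Priv G T i u then c (α u) else c' (β u)) ?_ ?_
  · intro l u hu
    by_cases hl : l = i
    · subst hl
      simpa only [if_pos hu, triColor_self] using hc2 _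
    · simp only [if_neg (other l u hl hu).1]
      rcases triColor_of_ne j hl with h | h <;> rw [h]
      · exact (hc0 _).1
      · exact (hc0 _).2
  · intro l m u v hu hv huv
    by_cases hl : l = i <;> by_cases hm : m = i
    · subst hl; subst hm
      simp only [if_pos hu, if_pos hv]
      exact hc _ _ (hα u v hu hv huv)
    · subst hl
      simp only [if_pos hu, if_neg (other m v hm hv).1]
      exact hcc _ _
    · subst hm
      simp only [if_pos hv, if_neg (other l u hl hu).1]
      exact (hcc _ _).symm
    · simp only [if_neg (other l u hl hu).1, if_neg (other m v hm hv).1]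
      exact hc' _ _ (hβ u v (other l u hl hu).2 (other m v hm hv).2 huv)

theorem colorable_of_isEmpty_class (H : SparseFar G T) {i j k : Fin 3} (hij : i ≠ j) (hik : i ≠ k)
    (hjk : j ≠ k) (hk : ∀ u, ¬ Priv G T k u) : G.Colorable 4 := by
  obtain ⟨β, hβ⟩ := H.thin.matching (Priv G T j) (T j) fun u hu => (hu j).2 rfl
  exact H.colorable_of_bool hij hik hjk β fun u v hu hv =>
    hβ u v (hu.resolve_right (hk u)) (hv.resolve_right (hk v))

/-- It suffices that every class is independent after removing a common independent set. -/
theorem colorable_of_indep (H : SparseFar G T) (X : V → Prop)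
    (hX : ∀ u v, X u → X v → ¬ G.Adj u v)
    (h : ∀ i u v, Priv G T i u → Priv G T i v → ¬ X u → ¬ X v → ¬ G.Adj u v) :
    G.Colorable 4 := by
  classical
  have hp : ∀ u, ∃ m : Fin 3, ∀ l, Priv G T l u → l = m := by
    intro u
    by_cases hu : ∃ l, Priv G T l u
    · exact ⟨hu.choose, fun l hl => hl.index_unique hu.choose_spec⟩
    · exact ⟨0, fun l hl => (hu ⟨l, hl⟩).elim⟩
  choose m hm using hp
  have s1 : ∀ i : Fin 3, i.castSucc ≠ (i + 1).castSucc := by decide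
  have s2 : ∀ i : Fin 3, i.castSucc ≠ (3 : Fin 4) := by decide
  refine H.colorable_of_near (fun i => (i + 1).castSucc)
    (fun i j e => by simpa using e)
    (fun u => if X u then 3 else (m u).castSucc) ?_ ?_
  · intro i u hu
    by_cases hx : X u
    · simp only [if_pos hx]
      exact (s2 _).symm
    · simp only [if_neg hx]
      rw [← hm u i hu]
      exact s1 i
  · intro i j u v hu hv huv
    by_cases hx : X u <;> by_cases hy : X v
    · exact (hX u v hx hy huv).elim
    · simp only [if_pos hx, if_neg hy]
      exact (s2 _).symm
    · simp only [if_neg hx, if_pos hy]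
      exact s2 _
    · simp only [if_neg hx, if_neg hy]
      rw [← hm u i hu, ← hm v j hv]
      intro e
      obtain rfl : i = j := Fin.castSucc_injective _ e
      exact h i u v hu hv hx hy huv

theorem adj_of_not_adj (H : SparseFar G T) {i j : Fin 3} (hij : i ≠ j) {d x y : V}
    (hd : Far G T d) (hx : Priv G T i x) (hdx : G.Adj d x) (hy : Priv G T j y)
    (hdy : ¬ G.Adj d y) : G.Adj y x :=
  (adj_or_adj_of_edge H.thin H.tri hij (fun l _ => hd l) hx.not_adj hdx hy).resolve_left
    fun h => hdy h.symm

theorem not_adj_of_two (H : SparseFar G T) {i j k : Fin 3} (hij : i ≠ j) (hik : i ≠ k)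
    (hjk : j ≠ k) {d y z u v : V} (hd : Far G T d) (hy : Priv G T j y) (hdy : G.Adj d y)
    (hz : Priv G T k z) (hdz : G.Adj d z) (hu : Priv G T i u) (hdu : ¬ G.Adj d u)
    (hv : Priv G T i v) (hdv : ¬ G.Adj d v) : ¬ G.Adj u v := by
  intro huv
  have := H.thin.tri u v y z huv
    (H.adj_of_not_adj hij.symm hd hy hdy hu hdu).symm
    (H.adj_of_not_adj hij.symm hd hy hdy hv hdv).symm
    (H.adj_of_not_adj hik.symm hd hz hdz hu hdu).symm
    (H.adj_of_not_adj hik.symm hd hz hdz hv hdv).symm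
  subst this
  exact hjk (hy.index_unique hz)

theorem colorable_of_one (H : SparseFar G T) {i j k : Fin 3} (hij : i ≠ j) (hik : i ≠ k)
    (hjk : j ≠ k) {d x : V} (hd : Far G T d) (hx : Priv G T i x) (hdx : G.Adj d x)
    (hj : ∀ y, Priv G T j y → ¬ G.Adj d y) (hk : ∀ z, Priv G T k z → ¬ G.Adj d z) :
    G.Colorable 4 := by
  obtain ⟨β, hβ⟩ := H.thin.matching (fun u => Priv G T j u ∨ Priv G T k u) x (by
    rintro u (hu | hu)
    · exact H.adj_of_not_adj hij hd hx hdx hu (hj u hu)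
    · exact H.adj_of_not_adj hik hd hx hdx hu (hk u hu))
  exact H.colorable_of_bool hij hik hjk β hβ

theorem isEmpty_class_of_adj (H : SparseFar G T) {i j k : Fin 3} (hij : i ≠ j) (hik : i ≠ k)
    (hjk : j ≠ k) {d x y : V} (hd : Far G T d) (hx : Priv G T i x) (hdx : G.Adj d x)
    (hy : Priv G T j y) (hdy : G.Adj d y) (hk : ∀ z, Priv G T k z → ¬ G.Adj d z) {u v : V}
    (hu : Priv G T i u) (hux : u ≠ x) (hv : Priv G T i v) (hvx : v ≠ x) (huv : G.Adj u v)
    (w : V) : ¬ Priv G T k w := by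
  intro hw
  have hdu : ¬ G.Adj d u := fun h => hux (H.unique d i u x hd hu hx h hdx)
  have hdv : ¬ G.Adj d v := fun h => hvx (H.unique d i v x hd hv hx h hdx)
  have huy := H.adj_of_not_adj hij.symm hd hy hdy hu hdu
  have hvy := H.adj_of_not_adj hij.symm hd hy hdy hv hdv
  have hwy := H.adj_of_not_adj hjk hd hy hdy hw (hk w hw)
  rcases adj_or_adj_of_edge H.thin H.tri hik hu.not_adj hv.not_adj huv hw with h | h
  · obtain rfl := H.thin.tri u y v w huy huv.symm hvy h hwy
    exact hik (hv.index_unique hw)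
  · obtain rfl := H.thin.tri v y u w hvy huv huy h hwy
    exact hik (hu.index_unique hw)

theorem colorable_of_two (H : SparseFar G T) {i j k : Fin 3} (hij : i ≠ j) (hik : i ≠ k)
    (hjk : j ≠ k) {d x y : V} (hd : Far G T d) (hx : Priv G T i x) (hdx : G.Adj d x)
    (hy : Priv G T j y) (hdy : G.Adj d y) (hk : ∀ z, Priv G T k z → ¬ G.Adj d z) :
    G.Colorable 4 := by
  by_cases hne : ∀ w, ¬ Priv G T k w
  · exact H.colorable_of_isEmpty_class hij hik hjk hne
  have hkx : ∀ w, Priv G T k w → G.Adj w x := fun w hw =>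
    H.adj_of_not_adj hik hd hx hdx hw (hk w hw)
  have hky : ∀ w, Priv G T k w → G.Adj w y := fun w hw =>
    H.adj_of_not_adj hjk hd hy hdy hw (hk w hw)
  have hxy : ¬ G.Adj x y := by
    intro hxy
    refine hne fun w hw => hw.not_far ?_
    rwa [H.thin.tri x y w d hxy (hkx w hw) (hky w hw) hdx hdy]
  refine H.colorable_of_indep (fun u => u = x ∨ u = y) ?_ ?_
  · rintro u v (rfl | rfl) (rfl | rfl) h
    · exact h.ne rfl
    · exact hxy h
    · exact hxy h.symm
    · exact h.ne rfl
  · intro l u v hu hv hux hvx huv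
    push Not at hux hvx
    rcases eq_or_eq_or_eq_fin_three hij hik hjk l with rfl | rfl | rfl
    · exact hne (H.isEmpty_class_of_adj hij hik hjk hd hx hdx hy hdy hk hu hux.1 hv hvx.1 huv)
    · exact hne (H.isEmpty_class_of_adj hij.symm hjk hik hd hy hdy hx hdx hk hu hux.2 hv hvx.2 huv)
    · obtain rfl := H.thin.tri u v x y huv (hkx u hu).symm (hkx v hv).symm (hky u hu).symm
        (hky v hv).symm
      exact hij (hx.index_unique hy)

theorem not_adj_of_triangle (H : SparseFar G T) {i j k : Fin 3} (hij : i ≠ j) (hik : i ≠ k)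
    (hjk : j ≠ k) {d x y z : V} (hd : Far G T d) (hx : Priv G T i x) (hdx : G.Adj d x)
    (hy : Priv G T j y) (hdy : G.Adj d y) (hz : Priv G T k z) (hdz : G.Adj d z)
    (hxy : G.Adj x y) {u v : V} (hu : Priv G T i u) (hv : Priv G T i v) : ¬ G.Adj u v := by
  intro huv
  have key : ∀ w, Priv G T i w → ¬ G.Adj w x := by
    intro w hw hwx
    have hdw : ¬ G.Adj d w := fun h => hwx.ne (H.unique d i w x hd hw hx h hdx)
    have hwy := H.adj_of_not_adj hij.symm hd hy hdy hw hdw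
    obtain rfl := H.thin.tri x y w d hxy hwx hwy hdx hdy
    exact hw.not_far hd
  by_cases hux : u = x
  · subst hux
    exact key v hv huv.symm
  by_cases hvx : v = x
  · subst hvx
    exact key u hu huv
  exact H.not_adj_of_two hij hik hjk hd hy hdy hz hdz
    hu (fun h => hux (H.unique d i u x hd hu hx h hdx))
    hv (fun h => hvx (H.unique d i v x hd hv hx h hdx)) huv

theorem colorable_of_three_adj (H : SparseFar G T) {i j k : Fin 3} (hij : i ≠ j) (hik : i ≠ k)
    (hjk : j ≠ k) {d x y z : V} (hd : Far G T d) (hx : Priv G T i x) (hdx : G.Adj d x)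
    (hy : Priv G T j y) (hdy : G.Adj d y) (hz : Priv G T k z) (hdz : G.Adj d z)
    (hxy : G.Adj x y) : G.Colorable 4 := by
  refine H.colorable_of_indep (fun _ => False) (fun _ _ h => h.elim) ?_
  intro l u v hu hv _ _ huv
  rcases eq_or_eq_or_eq_fin_three hij hik hjk l with rfl | rfl | rfl
  · exact H.not_adj_of_triangle hij hik hjk hd hx hdx hy hdy hz hdz hxy hu hv huv
  · exact H.not_adj_of_triangle hij.symm hjk hik hd hy hdy hx hdx hz hdz hxy.symm hu hv huv
  · have key : ∀ w, Priv G T l w → G.Adj d w := by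
      intro w hw
      by_contra hdw
      obtain rfl := H.thin.tri x y w d hxy (H.adj_of_not_adj hik hd hx hdx hw hdw)
        (H.adj_of_not_adj hjk hd hy hdy hw hdw) hdx hdy
      exact hw.not_far hd
    exact huv.ne (H.unique d l u v hd hu hv (key u hu) (key v hv))

theorem colorable_of_three (H : SparseFar G T) {i j k : Fin 3} (hij : i ≠ j) (hik : i ≠ k)
    (hjk : j ≠ k) {d x y z : V} (hd : Far G T d) (hx : Priv G T i x) (hdx : G.Adj d x)
    (hy : Priv G T j y) (hdy : G.Adj d y) (hz : Priv G T k z) (hdz : G.Adj d z) :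
    G.Colorable 4 := by
  by_cases hxy : G.Adj x y
  · exact H.colorable_of_three_adj hij hik hjk hd hx hdx hy hdy hz hdz hxy
  by_cases hxz : G.Adj x z
  · exact H.colorable_of_three_adj hik hij hjk.symm hd hx hdx hz hdz hy hdy hxz
  by_cases hyz : G.Adj y z
  · exact H.colorable_of_three_adj hjk hij.symm hik.symm hd hy hdy hz hdz hx hdx hyz
  refine H.colorable_of_indep (G.Adj d) ?_ ?_
  · have cls : ∀ u, G.Adj d u → u = x ∨ u = y ∨ u = z := by
      intro u hdu
      rcases eq_or_far_or_priv H.thin H.tri u with ⟨l, rfl⟩ | hu | ⟨l, hu⟩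
      · exact (hd l hdu).elim
      · exact (H.indep d u hd hu hdu).elim
      · rcases eq_or_eq_or_eq_fin_three hij hik hjk l with rfl | rfl | rfl
        · exact Or.inl (H.unique d l u x hd hu hx hdu hdx)
        · exact Or.inr (Or.inl (H.unique d l u y hd hu hy hdu hdy))
        · exact Or.inr (Or.inr (H.unique d l u z hd hu hz hdu hdz))
    intro u v hu hv huv
    have := huv.ne
    have := huv.symm
    rcases cls u hu with rfl | rfl | rfl <;> rcases cls v hv with rfl | rfl | rfl <;> contradiction
  · intro l u v hu hv hdu hdv
    rcases eq_or_eq_or_eq_fin_three hij hik hjk l with rfl | rfl | rfl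
    · exact H.not_adj_of_two hij hik hjk hd hy hdy hz hdz hu hdu hv hdv
    · exact H.not_adj_of_two hij.symm hjk hik hd hx hdx hz hdz hu hdu hv hdv
    · exact H.not_adj_of_two hik.symm hjk.symm hij hd hx hdx hy hdy hu hdu hv hdv

theorem colorable (H : SparseFar G T) {d x : V} {i : Fin 3} (hd : Far G T d)
    (hx : Priv G T i x) (hdx : G.Adj d x) : G.Colorable 4 := by
  obtain ⟨j, hj, -⟩ := exists_ne_ne_fin_three i i
  obtain ⟨k, hk, hkj⟩ := exists_ne_ne_fin_three i j
  by_cases hy : ∃ y, Priv G T j y ∧ G.Adj d y <;> by_cases hz : ∃ z, Priv G T k z ∧ G.Adj d z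
  · obtain ⟨y, hy, hdy⟩ := hy
    obtain ⟨z, hz, hdz⟩ := hz
    exact H.colorable_of_three hj.symm hk.symm hkj.symm hd hx hdx hy hdy hz hdz
  · obtain ⟨y, hy, hdy⟩ := hy
    exact H.colorable_of_two hj.symm hk.symm hkj.symm hd hx hdx hy hdy
      fun z h h' => hz ⟨z, h, h'⟩
  · obtain ⟨z, hz, hdz⟩ := hz
    exact H.colorable_of_two hk.symm hj.symm hkj hd hx hdx hz hdz
      fun y h h' => hy ⟨y, h, h'⟩
  · exact H.colorable_of_one hj.symm hk.symm hkj.symm hd hx hdx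
      (fun y h h' => hy ⟨y, h, h'⟩) fun z h h' => hz ⟨z, h, h'⟩

end SparseFar

/-- If two far vertices `u`, `v` are adjacent, then `x` is the only vertex in any class and `u v` is
the only edge between far vertices. -/
theorem colorable_of_far_edge (hG : ThinP2P3Free G) (hT : ∀ i j, i ≠ j → G.Adj (T i) (T j))
    {x u v : V} {i : Fin 3} (hx : Priv G T i x)
    (hu : Far G T u) (hv : Far G T v) (huv : G.Adj u v) : G.Colorable 4 := by
  classical
  have both : ∀ l w p q, Priv G T l w → Far G T p → Far G T q → G.Adj p q → G.Adj w p := by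
    intro l w p q hw hp hq hpq
    obtain ⟨m, hm, -⟩ := exists_ne_ne_fin_three l l
    rcases adj_or_adj_of_edge hG hT hm (fun l _ => hp l) (fun l _ => hq l) hpq hw with h | h
    · exact h
    · exact adj_of_path hG hT l hw.not_adj (fun l _ => hq l) (fun l _ => hp l) h hpq.symm
        (fun e => hw.not_far (e ▸ hp))
  have only : ∀ l w, Priv G T l w → w = x := fun l w hw =>
    hG.tri u v w x huv (both l w u v hw hu hv huv) (both l w v u hw hv hu huv.symm)
      (both i x u v hx hu hv huv) (both i x v u hx hv hu huv.symm)
  have hxu := both i x u v hx hu hv huv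
  have hxv := both i x v u hx hv hu huv.symm
  have noadj : ∀ w, Far G T w → G.Adj w x → w = u ∨ w = v := by
    intro w hw hwx
    by_contra! h
    have hwu := adj_of_path hG hT i (fun l _ => hw l) hx.not_adj (fun l _ => hu l) hwx hxu h.1
    exact h.2 (hG.tri x u w v hxu hwx hwu hxv.symm huv.symm)
  have edge : ∀ p q, Far G T p → Far G T q → G.Adj p q → p = u ∨ p = v := fun p q hp hq hpq =>
    noadj p hp (both i x p q hx hp hq hpq).symm
  obtain ⟨j, hj, -⟩ := exists_ne_ne_fin_three i i
  have hxnu : u ≠ x := hxu.ne.symm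
  have hxnv : v ≠ x := hxv.ne.symm
  let g : V → Fin 4 := fun w => if w = x then 3 else if w = u then 0 else 1
  have gx : g x = 3 := by simp [g]
  have gf : ∀ w, Far G T w → g w ≠ 3 := by
    intro w hw
    have : w ≠ x := fun e => hx.not_far (e ▸ hw)
    simp only [g, if_neg this]
    split_ifs <;> decide
  have gu : g u = 0 := by simp [g, hxnu]
  have gv : g v = 1 := by simp [g, hxnv, huv.ne.symm]
  refine colorable_of_off_triangle hG hT (triColor i j) (triColor_injective hj.symm) g ?_ ?_
  · intro l w hw
    rw [only l w hw, gx]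
    have : ∀ i j l, (3 : Fin 4) ≠ triColor i j l := by decide
    exact this i j l
  · rintro p q (hp | ⟨l, hp⟩) (hq | ⟨m, hq⟩) hpq
    · have := hpq.ne
      rcases edge p q hp hq hpq with rfl | rfl <;> rcases edge q _ hq hp hpq.symm with rfl | rfl
      · exact (this rfl).elim
      · rw [gu, gv]; decide
      · rw [gu, gv]; decide
      · exact (this rfl).elim
    · rw [only m q hq, gx]
      exact gf p hp
    · rw [only l p hp, gx]
      exact (gf q hq).symm
    · exact (hpq.ne ((only l p hp).trans (only m q hq).symm)).elim

theorem colorable_of_two_same_class (hG : ThinP2P3Free G)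
    (hT : ∀ i j, i ≠ j → G.Adj (T i) (T j)) (hI : ∀ u v, Far G T u → Far G T v → ¬ G.Adj u v)
    {d p q : V} {i : Fin 3} (hd : Far G T d) (hp : Priv G T i p) (hq : Priv G T i q)
    (hdp : G.Adj d p) (hdq : G.Adj d q) (hne : p ≠ q) : G.Colorable 4 := by
  classical
  have hpq := adj_of_path hG hT i hp.not_adj (fun l _ => hd l) hq.not_adj hdp.symm hdq hne
  have only : ∀ l w, Priv G T l w → l = i := by
    intro l w hw
    by_contra hl
    have hl' : i ≠ l := Ne.symm hl
    have hdn : ∀ m, m ≠ i → ¬ G.Adj d (T m) := fun m _ => hd m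
    have e1 := adj_or_adj_of_edge hG hT hl' hdn hp.not_adj hdp hw
    have e2 := adj_or_adj_of_edge hG hT hl' hdn hq.not_adj hdq hw
    have e3 := adj_or_adj_of_edge hG hT hl' hp.not_adj hq.not_adj hpq hw
    have n1 : ¬ (G.Adj w d ∧ G.Adj w p) := fun h =>
      hl' (hq.index_unique (hG.tri d p q w hdp hdq.symm hpq.symm h.1 h.2 ▸ hw))
    have n2 : ¬ (G.Adj w d ∧ G.Adj w q) := fun h =>
      hl' (hp.index_unique (hG.tri d q p w hdq hdp.symm hpq h.1 h.2 ▸ hw))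
    have n3 : ¬ (G.Adj w p ∧ G.Adj w q) := fun h =>
      hw.not_far (hG.tri p q d w hpq hdp hdq h.1 h.2 ▸ hd)
    tauto
  obtain ⟨α, hα⟩ := hG.matching (Priv G T i) (T i) fun u hu => (hu i).2 rfl
  obtain ⟨j, hj, -⟩ := exists_ne_ne_fin_three i i
  let c : Bool → Fin 4 := fun b => if b then 0 else 1
  have hc : ∀ a b, a ≠ b → c a ≠ c b := by decide
  have hc2 : ∀ a, c a ≠ 2 := by decide
  refine colorable_of_off_triangle hG hT (triColor i j) (triColor_injective hj.symm)
    (fun u => if Far G T u then 2 else c (α u)) ?_ ?_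
  · intro l u hu
    obtain rfl := only l u hu
    simpa only [if_neg hu.not_far, triColor_self] using hc2 _
  · rintro u v (hu | ⟨l, hu⟩) (hv | ⟨m, hv⟩) huv
    · exact (hI u v hu hv huv).elim
    · simp only [if_pos hu, if_neg hv.not_far]
      exact (hc2 _).symm
    · simp only [if_pos hv, if_neg hu.not_far]
      exact hc2 _
    · obtain rfl := only l u hu
      obtain rfl := only m v hv
      simp only [if_neg hu.not_far, if_neg hv.not_far]
      exact hc _ _ (hα u v hu hv huv)

theorem colorable_of_far (hconn : G.Connected) (hG : ThinP2P3Free G)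
    (hT : ∀ i j, i ≠ j → G.Adj (T i) (T j)) {v : V} (hv : Far G T v) : G.Colorable 4 := by
  obtain ⟨w⟩ := hconn.preconnected v (T 0)
  obtain ⟨e, -, hd, hx⟩ := w.exists_boundary_dart {u | Far G T u} hv
    (fun h => h.ne hT 0 rfl)
  have hdx : G.Adj e.fst e.snd := e.adj
  replace hd : Far G T e.fst := hd
  obtain ⟨i, hx⟩ : ∃ i, Priv G T i e.snd := by
    rcases eq_or_far_or_priv hG hT e.snd with ⟨i, hi⟩ | h | h
    · exact (hd i (hi ▸ hdx)).elim
    · exact (hx h).elim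
    · exact h
  by_contra hcol
  have hI : ∀ u v, Far G T u → Far G T v → ¬ G.Adj u v := fun u v hu hv huv =>
    hcol (colorable_of_far_edge hG hT hx hu hv huv)
  refine hcol (SparseFar.colorable ⟨hG, hT, hI, fun d i p q hd hp hq hdp hdq => ?_⟩ hd hx hdx)
  by_contra hne
  exact hcol (colorable_of_two_same_class hG hT hI hd hp hq hdp hdq hne)

end

/-- Every connected (P2 ∪ P3, diamond, K4)-free graph containing a
non-dominating triangle is 4-colorable. -/
theorem stmt0 {V : Type*} [Fintype V] (G : SimpleGraph V)
    (hconn : G.Connected)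
    (hP : IndFree p2p3 G) (hD : IndFree diamond G) (hK : IndFree K4 G)
    (a b c : V) (hab : G.Adj a b) (hac : G.Adj a c) (hbc : G.Adj b c)
    (v : V) (hv : v ∉ ({a, b, c} : Set V))
    (hva : ¬ G.Adj v a) (hvb : ¬ G.Adj v b) (hvc : ¬ G.Adj v c) :
    G.Colorable 4 := by
  refine colorable_of_far (T := ![a, b, c]) (v := v) hconn (.of_indFree hP hD hK) ?_ ?_
  · intro i j hij
    fin_cases i <;> fin_cases j <;> simp_all [G.adj_comm]
  · intro i
    fin_cases i <;> simpa
end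

section
/- Let G be a connected graph that is (P2 ∪ P3)-free, diamond-free and K4-free, and suppose every triangle in G is dominating. Then G is 6-colorable. -/
open SimpleGraph

namespace SimpleGraph

variable {V : Type*} {G : SimpleGraph V}

/-- In a graph without induced diamonds and without `K4`, the endpoints of an edge have at most
one common neighbor. -/
lemma eq_of_common_neighbors (hD : IndFree diamond G) (hK : IndFree K4 G) {a b c d : V}
    (hbd : G.Adj b d) (hab : G.Adj a b) (had : G.Adj a d) (hcb : G.Adj c b) (hcd : G.Adj c d) :
    a = c := by
  by_contra hne
  have hinj : Function.Injective ![a, b, c, d] := by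
    intro i j hij
    fin_cases i <;> fin_cases j <;>
      simp_all [hab.ne, hab.ne', had.ne, had.ne', hcb.ne, hcb.ne', hcd.ne, hcd.ne', hbd.ne,
        hbd.ne', Ne.symm hne]
  by_cases hac : G.Adj a c
  · refine hK ⟨⟨⟨![a, b, c, d], hinj⟩, ?_⟩⟩
    intro i j
    fin_cases i <;> fin_cases j <;>
      simp [K4, hac, hab, had, hcb, hcd, hbd, hac.symm, hab.symm, had.symm, hcb.symm, hcd.symm,
        hbd.symm]
  · have hca : ¬ G.Adj c a := fun h => hac h.symm
    refine hD ⟨⟨⟨![a, b, c, d], hinj⟩, ?_⟩⟩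
    intro i j
    fin_cases i <;> fin_cases j <;>
      simp [diamond, hac, hca, hab, had, hcb, hcd, hbd, hab.symm, had.symm, hcb.symm, hcd.symm,
        hbd.symm]

/-- In a triangle-free graph without induced `P2 ∪ P3`, the vertices anticomplete to a given edge
induce a graph of maximum degree at most one. -/
lemma eq_of_adj_of_anticomplete_edge (hP : IndFree p2p3 G)
    (htri : ∀ a b c : V, G.Adj a b → G.Adj a c → ¬ G.Adj b c) {u v x y z : V}
    (huv : G.Adj u v) (hxu : ¬ G.Adj x u) (hxv : ¬ G.Adj x v) (hyu : ¬ G.Adj y u)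
    (hyv : ¬ G.Adj y v) (hzu : ¬ G.Adj z u) (hzv : ¬ G.Adj z v) (hxy : G.Adj x y)
    (hxz : G.Adj x z) : y = z := by
  by_contra hne
  have hyz := htri x y z hxy hxz
  have hne_of {w : V} (hu : ¬ G.Adj w u) (hv : ¬ G.Adj w v) : w ≠ u ∧ w ≠ v :=
    ⟨by rintro rfl; exact hv huv, by rintro rfl; exact hu huv.symm⟩
  obtain ⟨hx1, hx2⟩ := hne_of hxu hxv
  obtain ⟨hy1, hy2⟩ := hne_of hyu hyv
  obtain ⟨hz1, hz2⟩ := hne_of hzu hzv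
  have hinj : Function.Injective ![u, v, y, x, z] := by
    intro i j hij
    fin_cases i <;> fin_cases j <;>
      simp_all [huv.ne, huv.ne', hxy.ne, hxy.ne', hxz.ne, hxz.ne', Ne.symm hne, hx1.symm,
        hx2.symm, hy1.symm, hy2.symm, hz1.symm, hz2.symm]
  refine hP ⟨⟨⟨![u, v, y, x, z], hinj⟩, ?_⟩⟩
  intro i j
  fin_cases i <;> fin_cases j <;>
    simp [p2p3, huv, huv.symm, hxy, hxy.symm, hxz, hxz.symm, hxu, hxv, hyu, hyv, hzu, hzv, hyz,
      G.adj_comm u x, G.adj_comm u y, G.adj_comm u z, G.adj_comm v x, G.adj_comm v y,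
      G.adj_comm v z, G.adj_comm z y]

/-- A set of vertices inducing a graph of maximum degree at most one can be properly colored with
two colors. -/
lemma exists_bool_coloring_on (S : Set V)
    (hS : ∀ x ∈ S, ∀ y ∈ S, ∀ z ∈ S, G.Adj x y → G.Adj x z → y = z) :
    ∃ f : V → Bool, ∀ x ∈ S, ∀ y ∈ S, G.Adj x y → f x ≠ f y := by
  classical
  let := linearOrderOfSTO (WellOrderingRel (α := V))
  have key : ∀ x ∈ S, ∀ y ∈ S, G.Adj x y → x < y →
      (∃ w ∈ S, G.Adj y w ∧ w < y) ∧ ¬ ∃ w ∈ S, G.Adj x w ∧ w < x := by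
    refine fun x hx y hy hxy hlt => ⟨⟨x, hx, hxy.symm, hlt⟩, ?_⟩
    rintro ⟨w, hw, hxw, hwx⟩
    exact lt_asymm hlt (hS x hx y hy w hw hxy hxw ▸ hwx)
  refine ⟨fun x => decide (∃ w ∈ S, G.Adj x w ∧ w < x), fun x hx y hy hxy => ?_⟩
  rcases lt_or_gt_of_ne hxy.ne with h | h
  · obtain ⟨h1, h2⟩ := key x hx y hy hxy h
    simp only [h1, h2, decide_true, decide_false, ne_eq, reduceCtorEq, not_false_eq_true]
  · obtain ⟨h1, h2⟩ := key y hy x hx hxy.symm h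
    simp only [h1, h2, decide_true, decide_false, ne_eq, reduceCtorEq, not_false_eq_true]

/-- A triangle-free graph without induced `P2 ∪ P3` is 4-colorable. -/
lemma colorable_four_of_triangle_free (hP : IndFree p2p3 G)
    (htri : ∀ a b c : V, G.Adj a b → G.Adj a c → ¬ G.Adj b c) : G.Colorable 4 := by
  classical
  by_cases hE : ∃ u v, G.Adj u v
  · obtain ⟨u, v, huv⟩ := hE
    obtain ⟨f, hf⟩ := exists_bool_coloring_on (G := G) {x | ¬ G.Adj x u ∧ ¬ G.Adj x v}
      fun x hx y hy z hz hxy hxz =>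
        eq_of_adj_of_anticomplete_edge hP htri huv hx.1 hx.2 hy.1 hy.2 hz.1 hz.2 hxy hxz
    let C : G.Coloring (Bool × Bool) := Coloring.mk
      (fun x => if G.Adj x u then (true, true) else if G.Adj x v then (true, false)
        else (false, f x)) <| by
      intro x y hxy
      have hu := htri u x y
      have hv := htri v x y
      have hfxy := hf x
      grind [SimpleGraph.adj_comm]
    simpa using C.colorable
  · push Not at hE
    exact ⟨Coloring.mk (fun _ => 0) fun {x y} h => (hE x y h).elim⟩

/-- A graph without induced diamonds and without `K4` that has a dominating triangle is
6-colorable. -/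
lemma colorable_six_of_dominating_triangle (hD : IndFree diamond G) (hK : IndFree K4 G)
    {a b c : V} (hab : G.Adj a b) (hac : G.Adj a c) (hbc : G.Adj b c)
    (hdom : ∀ v : V, v ∉ ({a, b, c} : Set V) → G.Adj v a ∨ G.Adj v b ∨ G.Adj v c) :
    G.Colorable 6 := by
  classical
  have hnbr (t : V) : ∃ f : V → Bool, ∀ x ∈ G.neighborSet t, ∀ y ∈ G.neighborSet t,
      G.Adj x y → f x ≠ f y :=
    exists_bool_coloring_on _ fun x hx y hy z hz hxy hxz =>
      eq_of_common_neighbors hD hK hx hy.symm hxy.symm hz.symm hxz.symm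
  obtain ⟨f, hf⟩ := hnbr a
  obtain ⟨g, hg⟩ := hnbr b
  obtain ⟨h, hh⟩ := hnbr c
  simp only [mem_neighborSet] at hf hg hh
  have hnab (v : V) (hv : v ≠ c) (hva : G.Adj v a) : ¬ G.Adj v b := fun hvb =>
    hv (eq_of_common_neighbors hD hK hab hva hvb hac.symm hbc.symm)
  have hnac (v : V) (hv : v ≠ b) (hva : G.Adj v a) : ¬ G.Adj v c := fun hvc =>
    hv (eq_of_common_neighbors hD hK hac hva hvc hab.symm hbc)
  have hnbc (v : V) (hv : v ≠ a) (hvb : G.Adj v b) : ¬ G.Adj v c := fun hvc =>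
    hv (eq_of_common_neighbors hD hK hbc hvb hvc hab hac)
  simp only [Set.mem_insert_iff, Set.mem_singleton_iff, not_or] at hdom
  let C : G.Coloring (Fin 3 × Bool) := Coloring.mk
    (fun v => if v = a then (1, true) else if v = b then (2, true) else if v = c then (0, true)
      else if G.Adj v a then (0, f v) else if G.Adj v b then (1, g v) else (2, h v)) <| by
    intro x y hxy
    have hfxy (hx : G.Adj x a) (hy : G.Adj y a) := hf x hx.symm y hy.symm hxy
    have hgxy (hx : G.Adj x b) (hy : G.Adj y b) := hg x hx.symm y hy.symm hxy
    have hhxy (hx : G.Adj x c) (hy : G.Adj y c) := hh x hx.symm y hy.symm hxy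
    have hx := hdom x
    have hy := hdom y
    have hyx := hxy.symm
    clear hf hg hh hdom
    split_ifs <;> grind
  simpa using C.colorable

end SimpleGraph

/-- Every connected (P2 ∪ P3, diamond, K4)-free graph in which every triangle
is dominating is 6-colorable. -/
theorem stmt1 {V : Type*} [Fintype V] (G : SimpleGraph V)
    (hconn : G.Connected)
    (hP : IndFree p2p3 G) (hD : IndFree diamond G) (hK : IndFree K4 G)
    (hdom : ∀ a b c : V, G.Adj a b → G.Adj a c → G.Adj b c →
      ∀ v : V, v ∉ ({a, b, c} : Set V) → (G.Adj v a ∨ G.Adj v b ∨ G.Adj v c)) :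
    G.Colorable 6 := by
  by_cases htri : ∃ a b c : V, G.Adj a b ∧ G.Adj a c ∧ G.Adj b c
  · obtain ⟨a, b, c, hab, hac, hbc⟩ := htri
    exact colorable_six_of_dominating_triangle hD hK hab hac hbc (hdom a b c hab hac hbc)
  · push Not at htri
    exact (colorable_four_of_triangle_free hP htri).mono (by norm_num)
end

section
/- Every graph that is (P2 ∪ P3)-free, diamond-free and K4-free is 6-colorable. -/
open SimpleGraph

/-- A finite set on which adjacency is transitive (a disjoint union of cliques) and which spans no
clique on `k + 1` vertices can be properly coloured with `k` colours. -/
theorem exists_proper_of_adj_trans {V : Type*} (G : SimpleGraph V) (k : ℕ) [NeZero k]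
    (S : Finset V)
    (htrans : ∀ x ∈ S, ∀ y ∈ S, ∀ z ∈ S, G.Adj x y → G.Adj y z → x ≠ z → G.Adj x z)
    (hclique : ∀ s ⊆ S, ¬ G.IsNClique (k + 1) s) :
    ∃ f : V → Fin k, ∀ x ∈ S, ∀ y ∈ S, G.Adj x y → f x ≠ f y := by
  classical
  induction S using Finset.induction_on with
  | empty => exact ⟨fun _ => 0, by simp⟩
  | insert v S hv ih =>
    obtain ⟨f, hf⟩ := ih
      (fun x hx y hy z hz => htrans x (Finset.mem_insert_of_mem hx) y
        (Finset.mem_insert_of_mem hy) z (Finset.mem_insert_of_mem hz))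
      (fun s hs => hclique s (hs.trans (Finset.subset_insert _ _)))
    set N := S.filter (G.Adj v) with hN
    have hNclique : G.IsClique (N : Set V) := by
      intro x hx y hy hxy
      simp only [hN, Finset.coe_filter, Set.mem_ofPred_eq] at hx hy
      exact htrans x (Finset.mem_insert_of_mem hx.1) v (Finset.mem_insert_self _ _) y
        (Finset.mem_insert_of_mem hy.1) hx.2.symm hy.2 hxy
    have hcard : N.card < k := by
      by_contra! h
      obtain ⟨s, hsN, hs⟩ := Finset.exists_subset_card_eq h
      have hs' : G.IsNClique k s := ⟨hNclique.subset (by exact_mod_cast hsN), hs⟩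
      refine hclique (insert v s) ?_ (hs'.insert fun b hb => (Finset.mem_filter.1 (hsN hb)).2)
      exact Finset.insert_subset_insert _ (hsN.trans (Finset.filter_subset _ _))
    obtain ⟨c, hc⟩ : ∃ c, c ∉ N.image f := by
      by_contra! h
      have h1 : (Finset.univ : Finset (Fin k)) ⊆ N.image f := fun c _ => h c
      have h2 := (Finset.card_le_card h1).trans Finset.card_image_le
      simp at h2
      omega
    have hc' : ∀ x ∈ S, G.Adj v x → f x ≠ c := fun x hx hvx h =>
      hc (Finset.mem_image.2 ⟨x, Finset.mem_filter.2 ⟨hx, hvx⟩, h⟩)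
    refine ⟨Function.update f v c, fun x hx y hy hxy => ?_⟩
    rcases Finset.mem_insert.1 hx with rfl | hxS <;> rcases Finset.mem_insert.1 hy with rfl | hyS
    · exact absurd hxy (G.irrefl)
    · rw [Function.update_self, Function.update_of_ne hxy.ne']
      exact (hc' y hyS hxy).symm
    · rw [Function.update_self, Function.update_of_ne hxy.ne]
      exact hc' x hxS hxy.symm
    · rw [Function.update_of_ne (by rintro rfl; exact hv hxS),
        Function.update_of_ne (by rintro rfl; exact hv hyS)]
      exact hf x hxS y hyS hxy

/-- In a `(P2 ∪ P3)`-free graph, adjacency is transitive on the set of vertices with no neighbour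
on a given edge `uv`. -/
theorem IndFree.adj_trans_of_not_adj_edge {V : Type*} {G : SimpleGraph V} (hP : IndFree p2p3 G)
    {u v x y z : V} (huv : G.Adj u v) (hxy : G.Adj x y) (hyz : G.Adj y z) (hxz : x ≠ z)
    (hux : ¬ G.Adj u x) (huy : ¬ G.Adj u y) (huz : ¬ G.Adj u z)
    (hvx : ¬ G.Adj v x) (hvy : ¬ G.Adj v y) (hvz : ¬ G.Adj v z) : G.Adj x z := by
  by_contra hn
  have hmap : ∀ i j, G.Adj (![u, v, x, y, z] i) (![u, v, x, y, z] j) ↔ p2p3.Adj i j := by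
    intro i j
    fin_cases i <;> fin_cases j <;> simp [p2p3, G.adj_comm, *]
  have hinj : Function.Injective ![u, v, x, y, z] := by
    intro i j
    fin_cases i <;> fin_cases j <;> simp <;> rintro rfl <;> simp_all [G.adj_comm]
  exact hP ⟨⟨⟨_, hinj⟩, hmap _ _⟩⟩

theorem IndFree.not_four_clique {V : Type*} {G : SimpleGraph V} (hK : IndFree K4 G)
    {a b c d : V} (hab : G.Adj a b) (hac : G.Adj a c) (had : G.Adj a d)
    (hbc : G.Adj b c) (hbd : G.Adj b d) (hcd : G.Adj c d) : False := by
  have hmap : ∀ i j, G.Adj (![a, b, c, d] i) (![a, b, c, d] j) ↔ K4.Adj i j := by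
    intro i j
    fin_cases i <;> fin_cases j <;> simp [K4, *] <;> simp [G.adj_comm, *]
  have hinj : Function.Injective ![a, b, c, d] := by
    intro i j h
    by_contra hij
    have := (hmap i j).2 hij
    rw [h] at this
    exact G.irrefl this
  exact hK ⟨⟨⟨_, hinj⟩, hmap _ _⟩⟩

/-- In a graph without diamond and `K4`, the endpoints of an edge have at most one common
neighbour. -/
theorem IndFree.common_neighbor_unique {V : Type*} {G : SimpleGraph V} (hD : IndFree diamond G)
    (hK : IndFree K4 G) {u v x y : V} (huv : G.Adj u v) (hux : G.Adj u x) (hvx : G.Adj v x)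
    (huy : G.Adj u y) (hvy : G.Adj v y) : x = y := by
  by_contra hne
  by_cases hxy : G.Adj x y
  · exact hK.not_four_clique huv hux huy hvx hvy hxy
  have hmap : ∀ i j, G.Adj (![x, u, y, v] i) (![x, u, y, v] j) ↔ diamond.Adj i j := by
    intro i j
    fin_cases i <;> fin_cases j <;> simp [diamond, *] <;> simp_all [G.adj_comm]
  have hinj : Function.Injective ![x, u, y, v] := by
    intro i j
    fin_cases i <;> fin_cases j <;> simp <;> rintro rfl <;> simp_all [G.adj_comm]
  exact hD ⟨⟨⟨_, hinj⟩, hmap _ _⟩⟩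

/-- A `(P2 ∪ P3)`-free graph without triangles is 4-colourable. -/
theorem IndFree.colorable_four_of_triangle_free {V : Type*} [Fintype V] {G : SimpleGraph V}
    (hP : IndFree p2p3 G) (hT : ∀ a b c, G.Adj a b → G.Adj a c → G.Adj b c → False) :
    G.Colorable 4 := by
  classical
  by_cases hE : ∃ a b, G.Adj a b
  swap
  · exact ⟨SimpleGraph.Coloring.mk (fun _ => 0) fun {a b} h => absurd ⟨a, b, h⟩ hE⟩
  obtain ⟨a, b, hab⟩ := hE
  obtain ⟨f, hf⟩ := exists_proper_of_adj_trans G 2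
    (Finset.univ.filter fun v => ¬ G.Adj a v ∧ ¬ G.Adj b v)
    (by
      simp only [Finset.mem_filter, Finset.mem_univ, true_and]
      intro x hx y hy z hz hxy hyz hxz
      exact hP.adj_trans_of_not_adj_edge hab hxy hyz hxz hx.1 hy.1 hz.1 hx.2 hy.2 hz.2)
    (by
      intro s _ hs
      obtain ⟨x, y, z, hxy, hxz, hyz, -⟩ := SimpleGraph.is3Clique_iff.1 hs
      exact hT x y z hxy hxz hyz)
  simp only [Finset.mem_filter, Finset.mem_univ, true_and] at hf
  let κ : V → Fin 2 ⊕ Fin 2 := fun v =>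
    if G.Adj a v then .inl 0 else if G.Adj b v then .inl 1 else .inr (f v)
  have hκ : ∀ x y, G.Adj x y → κ x ≠ κ y := by
    intro x y hxy
    simp only [κ]
    split_ifs with h1 h2 h3 h4 h5 h6 h7 h8 <;> simp
    · exact hT a x y h1 h2 hxy
    · exact hT b x y ‹_› ‹_› hxy
    · exact hf x ⟨‹_›, ‹_›⟩ y ⟨‹_›, ‹_›⟩ hxy
  exact (SimpleGraph.Coloring.mk κ fun {x y} h => hκ x y h).colorable

/-- A `(P2 ∪ P3, diamond, K4)`-free graph containing a triangle is 6-colourable. -/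
theorem IndFree.colorable_six_of_triangle {V : Type*} [Fintype V] {G : SimpleGraph V}
    (hP : IndFree p2p3 G) (hD : IndFree diamond G) (hK : IndFree K4 G)
    (t : Fin 3 → V) (ht : ∀ i j, i ≠ j → G.Adj (t i) (t j)) : G.Colorable 6 := by
  classical
  -- `A i` is the set of vertices outside the triangle attached to its vertex `t i`,
  -- and `M` is the set of vertices far from the triangle.
  let A : Fin 3 → V → Prop := fun i v => (∀ j, v ≠ t j) ∧ G.Adj (t i) v
  let M : V → Prop := fun v => (∀ j, v ≠ t j) ∧ ∀ j, ¬ G.Adj (t j) v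
  have hthird : ∀ i j : Fin 3, i ≠ j → ∃ k, k ≠ i ∧ k ≠ j := by decide
  have hothers : ∀ i : Fin 3, ∃ j k, j ≠ k ∧ j ≠ i ∧ k ≠ i := by decide
  have hA : ∀ i j v, A i v → j ≠ i → ¬ G.Adj (t j) v := by
    intro i j v hv hji hjv
    obtain ⟨k, hki, hkj⟩ := hthird i j hji.symm
    exact hv.1 k (hD.common_neighbor_unique hK (ht j i hji) hjv hv.2
      (ht j k hkj.symm) (ht i k hki.symm))
  have htrans : ∀ i x y z, (A i x ∨ M x) → (A i y ∨ M y) → (A i z ∨ M z) →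
      G.Adj x y → G.Adj y z → x ≠ z → G.Adj x z := by
    intro i x y z hx hy hz hxy hyz hxz
    obtain ⟨j, k, hjk, hji, hki⟩ := hothers i
    have hfar : ∀ l, l ≠ i → ∀ v, (A i v ∨ M v) → ¬ G.Adj (t l) v := fun l hl v hv =>
      hv.elim (fun h => hA i l v h hl) (fun h => h.2 l)
    exact hP.adj_trans_of_not_adj_edge (ht j k hjk) hxy hyz hxz (hfar j hji x hx)
      (hfar j hji y hy) (hfar j hji z hz) (hfar k hki x hx) (hfar k hki y hy) (hfar k hki z hz)
  have hfA : ∀ i, ∃ f : V → Fin 2, ∀ x, A i x → ∀ y, A i y → G.Adj x y → f x ≠ f y := by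
    intro i
    obtain ⟨f, hf⟩ := exists_proper_of_adj_trans G 2 (Finset.univ.filter (A i))
      (by
        simp only [Finset.mem_filter, Finset.mem_univ, true_and]
        exact fun x hx y hy z hz => htrans i x y z (.inl hx) (.inl hy) (.inl hz))
      (by
        intro s hsub hs
        obtain ⟨x, y, z, hxy, hxz, hyz, rfl⟩ := SimpleGraph.is3Clique_iff.1 hs
        simp only [Finset.insert_subset_iff, Finset.singleton_subset_iff, Finset.mem_filter,
          Finset.mem_univ, true_and] at hsub
        exact hK.not_four_clique hsub.1.2 hsub.2.1.2 hsub.2.2.2 hxy hxz hyz)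
    exact ⟨f, by simpa using hf⟩
  choose f hf using hfA
  obtain ⟨g, hg⟩ : ∃ g : V → Fin 3, ∀ x, M x → ∀ y, M y → G.Adj x y → g x ≠ g y := by
    obtain ⟨g, hg⟩ := exists_proper_of_adj_trans G 3 (Finset.univ.filter M)
      (by
        simp only [Finset.mem_filter, Finset.mem_univ, true_and]
        exact fun x hx y hy z hz => htrans 0 x y z (.inr hx) (.inr hy) (.inr hz))
      (by
        intro s _ hs
        obtain ⟨a, b, c, d, hab, hac, had, hbc, hbd, hcd, rfl⟩ := Finset.card_eq_four.1 hs.card_eq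
        have hadj := hs.isClique
        exact hK.not_four_clique (hadj (by simp) (by simp) hab) (hadj (by simp) (by simp) hac)
          (hadj (by simp) (by simp) had) (hadj (by simp) (by simp) hbc)
          (hadj (by simp) (by simp) hbd) (hadj (by simp) (by simp) hcd))
    exact ⟨g, by simpa using hg⟩
  let free : V → Fin 3 → Fin 2 → Prop := fun m i ε => ∀ x, A i x → G.Adj x m → f i x ≠ ε
  have hblocked : ∀ m i, (¬ ∃ ε, free m i ε) →
      ∃ x y, A i x ∧ A i y ∧ G.Adj x m ∧ G.Adj y m ∧ x ≠ y := by
    intro m i h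
    simp only [free, not_exists, not_forall, not_not] at h
    obtain ⟨x, hx, hxm, hfx⟩ := h 0
    obtain ⟨y, hy, hym, hfy⟩ := h 1
    refine ⟨x, y, hx, hy, hxm, hym, ?_⟩
    rintro rfl
    simp [hfx] at hfy
  have hfree_of_adj : ∀ m m', M m → M m' → G.Adj m m' → ∀ i, ∃ ε, free m i ε := by
    intro m m' hm hm' hmm' i
    by_contra h
    obtain ⟨x, y, hx, hy, hxm, hym, hxy⟩ := hblocked m i h
    have hadj : ∀ z, A i z → G.Adj z m → G.Adj m' z := fun z hz hzm =>
      (htrans i z m m' (.inl hz) (.inr hm) (.inr hm') hzm hmm'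
        (by rintro rfl; exact hm'.2 i hz.2)).symm
    exact hxy (hD.common_neighbor_unique hK hmm' hxm.symm (hadj x hx hxm) hym.symm
      (hadj y hy hym))
  have hfree : ∀ m, M m → ∃ i ε, free m i ε := by
    intro m hm
    by_contra! h
    obtain ⟨x, x', hx, hx', hxm, hxm', hxx⟩ := hblocked m 0 (by simpa using h 0)
    obtain ⟨y, -, hy, -, hym, -⟩ := hblocked m 1 (by simpa using h 1)
    have hadj : G.Adj x x' :=
      htrans 0 x m x' (.inl hx) (.inr hm) (.inl hx') hxm hxm'.symm hxx
    have hy0 : ¬ G.Adj (t 0) y := hA 1 0 y hy (by decide)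
    have hne : ∀ z, A 0 z → z ≠ y := by
      rintro z hz rfl
      exact hy0 hz.2
    have hxy : ¬ G.Adj x y := fun hxy => hne x' hx'
      (hD.common_neighbor_unique hK hxm hadj hxm'.symm hxy hym.symm)
    have hxy' : ¬ G.Adj x' y := fun hxy => hne x hx
      (hD.common_neighbor_unique hK hxm' hadj.symm hxm.symm hxy hym.symm)
    have hfar : ∀ z, A 0 z → ∀ j, j ≠ 0 → ¬ G.Adj z (t j) := fun z hz j hj hzj =>
      hA 0 j z hz hj hzj.symm
    exact hA 1 2 y hy (by decide) (hP.adj_trans_of_not_adj_edge hadj hy.2.symm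
      (ht 1 2 (by decide)) (hy.1 2) hxy (hfar x hx 1 (by decide)) (hfar x hx 2 (by decide))
      hxy' (hfar x' hx' 1 (by decide)) (hfar x' hx' 2 (by decide))).symm
  have htinj : ∀ i j, t i = t j → i = j := fun i j hij => by
    by_contra hne
    exact (ht i j hne).ne hij
  have hcol : ∀ v, ∃ κ : Fin 3 × Fin 2, (∀ i, v = t i → κ = (i + 1, 0)) ∧
      (∀ i, A i v → κ = (i, f i v)) ∧
      (M v → free v κ.1 κ.2 ∧ ∀ m, M m → G.Adj v m → κ.1 = g v) := by
    intro v
    by_cases hvt : ∃ i, v = t i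
    · obtain ⟨i, rfl⟩ := hvt
      exact ⟨(i + 1, 0), fun j hj => by rw [htinj i j hj], fun j hj => absurd rfl (hj.1 i),
        fun hM => absurd rfl (hM.1 i)⟩
    by_cases hvA : ∃ i, A i v
    · obtain ⟨i, hi⟩ := hvA
      refine ⟨(i, f i v), fun j hj => absurd hj (hi.1 j), fun j hj => ?_,
        fun hM => absurd hi.2 (hM.2 i)⟩
      obtain rfl : j = i := by
        by_contra hne
        exact hA i j v hi hne hj.2
      rfl
    by_cases hvM : ∃ m, M v ∧ M m ∧ G.Adj v m
    · obtain ⟨m, hv, hm, hvm⟩ := hvM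
      obtain ⟨ε, hε⟩ := hfree_of_adj v m hv hm hvm (g v)
      exact ⟨(g v, ε), fun j hj => absurd ⟨j, hj⟩ hvt, fun j hj => absurd ⟨j, hj⟩ hvA,
        fun _ => ⟨hε, fun _ _ _ => rfl⟩⟩
    · have hv : M v := ⟨fun j hj => hvt ⟨j, hj⟩,
        fun j hj => hvA ⟨j, fun k hk => hvt ⟨k, hk⟩, hj⟩⟩
      obtain ⟨i, ε, hε⟩ := hfree v hv
      exact ⟨(i, ε), fun j hj => absurd ⟨j, hj⟩ hvt, fun j hj => absurd ⟨j, hj⟩ hvA,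
        fun _ => ⟨hε, fun m hm hvm => absurd ⟨m, hv, hm, hvm⟩ hvM⟩⟩
  choose κ hκt hκA hκM using hcol
  have hcases : ∀ v, (∃ i, v = t i) ∨ (∃ i, A i v) ∨ M v := by
    intro v
    by_cases hvt : ∃ i, v = t i
    · exact .inl hvt
    by_cases hvA : ∃ i, A i v
    · exact .inr (.inl hvA)
    exact .inr (.inr ⟨fun j hj => hvt ⟨j, hj⟩, fun j hj => hvA ⟨j, fun k hk => hvt ⟨k, hk⟩, hj⟩⟩)
  have hsucc : ∀ i : Fin 3, i + 1 ≠ i := by decide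
  have htA : ∀ i j v, A j v → G.Adj (t i) v → κ (t i) ≠ κ v := by
    intro i j v hv hadj heq
    rw [hκt _ i rfl, hκA v j hv, Prod.mk.injEq] at heq
    obtain rfl : i = j := by
      by_contra hne
      exact hA j i v hv hne hadj
    exact hsucc i heq.1
  have hAM : ∀ i x m, A i x → M m → G.Adj x m → κ x ≠ κ m := by
    intro i x m hx hm hxm heq
    rw [hκA x i hx] at heq
    have := (hκM m hm).1
    rw [← heq] at this
    exact this x hx hxm rfl
  have hκ : ∀ x y, G.Adj x y → κ x ≠ κ y := by
    intro x y hxy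
    rcases hcases x with ⟨i, rfl⟩ | ⟨i, hx⟩ | hx <;> rcases hcases y with ⟨j, rfl⟩ | ⟨j, hy⟩ | hy
    · rw [hκt _ i rfl, hκt _ j rfl]
      intro heq
      rw [Prod.mk.injEq] at heq
      exact hxy.ne (congrArg t (add_right_cancel heq.1))
    · exact htA i j y hy hxy
    · exact absurd hxy (hy.2 i)
    · exact (htA j i x hx hxy.symm).symm
    · intro heq
      rw [hκA x i hx, hκA y j hy, Prod.mk.injEq] at heq
      obtain ⟨rfl, heq⟩ := heq
      exact hf i x hx y hy hxy heq
    · exact hAM i x y hx hy hxy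
    · exact absurd hxy.symm (hx.2 j)
    · exact (hAM j y x hy hx hxy.symm).symm
    · intro heq
      apply hg x hx y hy hxy
      rw [← (hκM x hx).2 y hy hxy, ← (hκM y hy).2 x hx hxy.symm, heq]
  exact (SimpleGraph.Coloring.mk κ fun {x y} h => hκ x y h).colorable

/-- Every (P2 ∪ P3, diamond, K4)-free graph is 6-colorable. -/
theorem stmt2 {V : Type*} [Fintype V] (G : SimpleGraph V)
    (hP : IndFree p2p3 G) (hD : IndFree diamond G) (hK : IndFree K4 G) :
    G.Colorable 6 := by
  by_cases hT : ∃ a b c, G.Adj a b ∧ G.Adj a c ∧ G.Adj b c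
  · obtain ⟨a, b, c, hab, hac, hbc⟩ := hT
    refine hP.colorable_six_of_triangle hD hK ![a, b, c] fun i j hij => ?_
    fin_cases i <;> fin_cases j <;> simp_all [G.adj_comm]
  · refine (hP.colorable_four_of_triangle_free fun a b c hab hac hbc => ?_).mono (by norm_num)
    exact hT ⟨a, b, c, hab, hac, hbc⟩
end

section
/- Every graph that is P6-free, diamond-free, bull-free and K4-free is 4-colorable. -/
open SimpleGraph

namespace SimpleGraph

variable {V : Type*} {G : SimpleGraph V}

theorem induce_colorable_iff {S : Set V} {n : ℕ} :
    (G.induce S).Colorable n ↔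
      ∃ c : V → ℕ, (∀ x ∈ S, c x < n) ∧ ∀ x ∈ S, ∀ y ∈ S, G.Adj x y → c x ≠ c y := by
  classical
  constructor
  · rintro ⟨c⟩
    refine ⟨fun x => if h : x ∈ S then c ⟨x, h⟩ else 0, fun x hx => by simp [hx], ?_⟩
    intro x hx y hy hxy
    have := c.valid (show (G.induce S).Adj ⟨x, hx⟩ ⟨y, hy⟩ from hxy)
    simpa [hx, hy, Fin.ext_iff] using this
  · rintro ⟨c, hlt, hc⟩
    exact ⟨Coloring.mk (fun x => (⟨c x, hlt x x.2⟩ : Fin n)) fun {x y} hxy h =>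
      hc x x.2 y y.2 hxy (congrArg Fin.val h)⟩

theorem Colorable.induce_union {A B : Set V} {n : ℕ} (hA : (G.induce A).Colorable n)
    (hB : (G.induce B).Colorable n) (hAB : ∀ x ∈ A, ∀ y ∈ B, ¬ G.Adj x y) :
    (G.induce (A ∪ B)).Colorable n := by
  classical
  rw [induce_colorable_iff] at *
  obtain ⟨a, ha, ha'⟩ := hA
  obtain ⟨b, hb, hb'⟩ := hB
  refine ⟨fun x => if x ∈ A then a x else b x, ?_, ?_⟩
  · grind
  · intro x hx y hy hxy
    have := hxy.symm
    grind

theorem Colorable.induce_union_isIndepSet {D I : Set V} {n : ℕ} (hD : (G.induce D).Colorable n)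
    (hI : G.IsIndepSet I) : (G.induce (D ∪ I)).Colorable (n + 1) := by
  classical
  rw [induce_colorable_iff] at *
  obtain ⟨c, hc, hc'⟩ := hD
  refine ⟨fun x => if x ∈ D then c x else n, by grind, ?_⟩
  intro x hx y hy hxy
  have hne := hxy.ne
  have : x ∈ I → y ∈ I → False := fun h h' => hI h h' hne hxy
  grind

/-- Every proper nonempty part of `C` is joined by an edge to the rest of `C`. -/
def ConnectedOn (G : SimpleGraph V) (C : Set V) : Prop :=
  ∀ A ⊆ C, A.Nonempty → (C \ A).Nonempty → ∃ x ∈ A, ∃ y ∈ C \ A, G.Adj x y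

theorem exists_connectedOn_not_colorable [Finite V] {D : Set V} {n : ℕ}
    (hD : ¬ (G.induce D).Colorable n) :
    ∃ C ⊆ D, G.ConnectedOn C ∧ ¬ (G.induce C).Colorable n ∧
      ∀ x ∈ C, ∀ y ∈ D \ C, ¬ G.Adj x y := by
  obtain ⟨C, hC⟩ := (Set.toFinite {C : Set V | C ⊆ D ∧ ¬ (G.induce C).Colorable n ∧
    ∀ x ∈ C, ∀ y ∈ D \ C, ¬ G.Adj x y}).exists_minimal ⟨D, subset_rfl, hD, by simp⟩
  obtain ⟨hCD, hcol, hsep⟩ := hC.prop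
  refine ⟨C, hCD, ?_, hcol, hsep⟩
  intro A hAC hA hCA
  by_contra! hno
  have key : ∀ B ⊆ C, (C \ B).Nonempty → (∀ x ∈ B, ∀ y ∈ C \ B, ¬ G.Adj x y) →
      (G.induce B).Colorable n := by
    intro B hBC ⟨z, hzC, hzB⟩ hB
    by_contra hBcol
    refine hzB (hC.le_of_le ⟨hBC.trans hCD, hBcol, fun x hx y hy => ?_⟩ hBC hzC)
    by_cases hyC : y ∈ C
    · exact hB x hx y ⟨hyC, hy.2⟩
    · exact hsep x (hBC hx) y ⟨hy.1, hyC⟩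
  have h₁ := key A hAC hCA hno
  have h₂ := key (C \ A) Set.sdiff_subset (by rwa [Set.sdiff_sdiff_cancel_left hAC])
    (by rw [Set.sdiff_sdiff_cancel_left hAC]; exact fun x hx y hy h => hno y hy x hx h.symm)
  exact hcol (Set.union_sdiff_cancel hAC ▸ h₁.induce_union h₂ hno)

/-- A non-`n`-colorable part of `C` contains a connected non-`n`-colorable set attached to a vertex
of `C` outside that part. -/
theorem ConnectedOn.exists_attached [Finite V] {C D : Set V} {n : ℕ} (hC : G.ConnectedOn C)
    (hDC : D ⊆ C) (hne : (C \ D).Nonempty) (hD : ¬ (G.induce D).Colorable n) :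
    ∃ C' ⊆ D, G.ConnectedOn C' ∧ ¬ (G.induce C').Colorable n ∧
      ∃ w ∈ C \ D, ∃ x ∈ C', G.Adj w x := by
  obtain ⟨C', hC'D, hconn, hcol, hsep⟩ := exists_connectedOn_not_colorable hD
  have hC' : C'.Nonempty := by
    rw [Set.nonempty_iff_ne_empty]
    rintro rfl
    exact hcol (induce_colorable_iff.2 ⟨fun _ => 0, by simp, by simp⟩)
  obtain ⟨x, hx, w, hw, hxw⟩ := hC C' (hC'D.trans hDC) hC'
    (hne.mono (Set.sdiff_subset_sdiff_right hC'D))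
  exact ⟨C', hC'D, hconn, hcol, w, ⟨hw.1, fun h => hsep x hx w ⟨h, hw.2⟩ hxw⟩, x, hx, hxw.symm⟩

theorem pathGraph_cons {n : ℕ} (f : pathGraph (n + 1) ↪g G) {u : V} (hu : G.Adj u (f 0))
    (hne : ∀ i ≠ 0, u ≠ f i) (hadj : ∀ i ≠ 0, ¬ G.Adj u (f i)) :
    ∃ g : pathGraph (n + 2) ↪g G, g 0 = u ∧ ∀ i : Fin (n + 1), g i.succ = f i := by
  have hne' : ∀ i, u ≠ f i := fun i => by
    by_cases h : i = 0
    · exact h ▸ hu.ne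
    · exact hne i h
  have hadj' : ∀ i, G.Adj u (f i) ↔ i = 0 := fun i =>
    ⟨fun h => by_contra fun hi => hadj i hi h, fun h => h ▸ hu⟩
  refine ⟨⟨⟨Fin.cons u f, ?_⟩, ?_⟩, rfl, fun i => rfl⟩
  · rw [Fin.cons_injective_iff]
    exact ⟨fun ⟨i, hi⟩ => hne' i hi.symm, f.injective⟩
  · intro i j
    refine Fin.cases ?_ (fun i => ?_) i <;> refine Fin.cases ?_ (fun j => ?_) j
    · simp
    · change G.Adj u (f j) ↔ _
      rw [hadj', pathGraph_adj, Fin.ext_iff, Fin.val_succ, Fin.val_zero, Fin.val_zero]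
      omega
    · change G.Adj (f i) u ↔ _
      rw [G.adj_comm, hadj', pathGraph_adj, Fin.ext_iff, Fin.val_succ, Fin.val_zero, Fin.val_zero]
      omega
    · simp [pathGraph_adj]

theorem ConnectedOn.exists_inducedPath [Finite V] (hG : G.CliqueFree 3) (n : ℕ) :
    ∀ {C : Set V} {u x : V}, G.ConnectedOn C → u ∉ C → x ∈ C → G.Adj u x →
      ¬ (G.induce C).Colorable n →
      ∃ f : pathGraph (n + 2) ↪g G, f 0 = u ∧ ∀ i ≠ 0, f i ∈ C := by
  induction n with
  | zero =>
    intro C u x _ _ hx hux _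
    refine ⟨⟨⟨![u, x], ?_⟩, ?_⟩, rfl, ?_⟩
    · simp [Function.Injective, Fin.forall_fin_two, hux.ne, hux.ne']
    · intro i j
      change G.Adj (![u, x] i) (![u, x] j) ↔ _
      fin_cases i <;> fin_cases j <;> simp [pathGraph_adj, hux, hux.symm]
    · intro i hi
      change ![u, x] i ∈ C
      fin_cases i <;> simp_all
  | succ n ih =>
    intro C u x hC hu hx hux hcol
    have hD : ¬ (G.induce (C \ G.neighborSet u)).Colorable n := fun h => hcol <| by
      have := h.induce_union_isIndepSet (isIndepSet_neighborSet_of_triangleFree G hG u)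
      exact this.of_hom (G.induceHomOfLE (by simp)).toHom
    obtain ⟨C', hC'D, hconn, hcol', w, hw, y, hy, hwy⟩ :=
      hC.exists_attached Set.sdiff_subset ⟨x, hx, by simp [hux]⟩ hD
    have huw : G.Adj u w := by simpa [hw.1] using hw.2
    obtain ⟨f, hf0, hf⟩ := ih hconn (fun h => (hC'D h).2 huw) hy hwy hcol'
    obtain ⟨g, hg0, hg⟩ := pathGraph_cons f (hf0 ▸ huw)
      (fun i hi h => hu (by rw [h]; exact (hC'D (hf i hi)).1)) (fun i hi => (hC'D (hf i hi)).2)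
    refine ⟨g, hg0, fun i hi => ?_⟩
    obtain ⟨j, rfl⟩ := Fin.exists_succ_eq.2 hi
    rw [hg]
    by_cases hj : j = 0
    · rw [hj, hf0]; exact hw.1
    · exact (hC'D (hf j hj)).1

/-- A triangle-free graph that needs more than `n + 2` colors has an induced path on `n + 4`
vertices. -/
theorem CliqueFree.exists_inducedPath [Finite V] (hG : G.CliqueFree 3) {n : ℕ}
    (hcol : ¬ G.Colorable (n + 2)) : Nonempty (pathGraph (n + 4) ↪g G) := by
  have huniv : ¬ (G.induce Set.univ).Colorable (n + 2) := fun h =>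
    hcol (h.of_hom (induceUnivIso G).symm.toHom)
  obtain ⟨C, -, hC, hCcol, -⟩ := exists_connectedOn_not_colorable huniv
  obtain ⟨v, hv⟩ : C.Nonempty := by
    rw [Set.nonempty_iff_ne_empty]
    rintro rfl
    exact hCcol (induce_colorable_iff.2 ⟨fun _ => 0, by simp, by simp⟩)
  have hD : ¬ (G.induce (C \ insert v (G.neighborSet v))).Colorable (n + 1) := fun h => hCcol <| by
    have hv1 : (G.induce {v}).Colorable (n + 1) :=
      induce_colorable_iff.2 ⟨fun _ => 0, by simp, by simp⟩
    have := (h.induce_union hv1 (by simp +contextual [G.adj_comm])).induce_union_isIndepSet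
      (isIndepSet_neighborSet_of_triangleFree G hG v)
    refine this.of_hom (G.induceHomOfLE fun x hx => ?_).toHom
    by_cases x = v <;> by_cases G.Adj v x <;> simp_all
  obtain ⟨C', hC'D, hconn, hcol', w, hw, y, hy, hwy⟩ :=
    hC.exists_attached Set.sdiff_subset ⟨v, hv, by simp⟩ hD
  have hvC' : ∀ x ∈ C', v ≠ x ∧ ¬ G.Adj v x := fun x hx => by
    have := (hC'D hx).2
    simp only [Set.mem_insert_iff, mem_neighborSet, not_or] at this
    exact ⟨Ne.symm this.1, this.2⟩
  have hvw : G.Adj v w := by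
    rcases (by simpa [hw.1, or_iff_not_imp_left] using hw.2 : w = v ∨ G.Adj v w) with rfl | h
    · exact absurd hwy (hvC' y hy).2
    · exact h
  obtain ⟨f, hf0, hf⟩ :=
    hconn.exists_inducedPath hG (n + 1) (fun h => (hvC' w h).2 hvw) hy hwy hcol'
  obtain ⟨g, -⟩ := pathGraph_cons f (hf0 ▸ hvw) (fun i hi => (hvC' _ (hf i hi)).1)
    (fun i hi => (hvC' _ (hf i hi)).2)
  exact ⟨g⟩

theorem Colorable.of_induce_compl_singleton [Fintype V] [DecidableRel G.Adj] {v : V} {n : ℕ}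
    (hv : G.degree v < n) (h : (G.induce {v}ᶜ).Colorable n) : G.Colorable n := by
  classical
  obtain ⟨c, hc, hc'⟩ := induce_colorable_iff.1 h
  obtain ⟨k, hk, hkv⟩ : ∃ k ∈ Finset.range n, k ∉ (G.neighborFinset v).image c :=
    Finset.exists_mem_notMem_of_card_lt_card
      (by simpa using Finset.card_image_le.trans_lt hv)
  simp only [Finset.mem_range] at hk
  refine Colorable.of_hom (induceUnivIso G).symm.toHom
    (induce_colorable_iff.2 ⟨Function.update c v k, ?_, ?_⟩)
  · intro x _
    by_cases hx : x = v
    · simp [hx, hk]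
    · simpa [hx] using hc x hx
  · intro x _ y _ hxy
    have hk' : ∀ z, G.Adj v z → c z ≠ k := fun z hz h => hkv (by
      simp only [Finset.mem_image, mem_neighborFinset]
      exact ⟨z, hz, h⟩)
    by_cases hx : x = v
    · subst hx
      simpa [hxy.ne'] using (hk' y hxy).symm
    · by_cases hy : y = v
      · subst hy
        simpa [hx] using hk' x hxy.symm
      · simpa [hx, hy] using hc' x hx y hy hxy

end SimpleGraph

section Forbidden

variable {V : Type*} {G : SimpleGraph V}

theorem IndFree.induce {α : Type*} {H : SimpleGraph α} (h : IndFree H G) (S : Set V) :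
    IndFree H (G.induce S) :=
  fun ⟨f⟩ => h ⟨(SimpleGraph.Embedding.induce S).comp f⟩

/-- Two vertices with two adjacent common neighbors coincide. -/
theorem eq_of_common_adj_adj (hD : IndFree diamond G) (hK : IndFree K4 G) {x x' y z : V}
    (hyz : G.Adj y z) (hxy : G.Adj x y) (hxz : G.Adj x z) (hxy' : G.Adj x' y)
    (hxz' : G.Adj x' z) : x = x' := by
  by_contra hne
  have hinj : Function.Injective ![x, y, x', z] := by
    simp [Function.Injective, Fin.forall_fin_succ, hne, Ne.symm hne, hyz.ne, hyz.ne', hxy.ne,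
      hxy.ne', hxz.ne, hxz.ne', hxy'.ne, hxy'.ne', hxz'.ne, hxz'.ne']
  by_cases h : G.Adj x x'
  · refine hK ⟨⟨⟨_, hinj⟩, ?_⟩⟩
    simp [K4, Fin.forall_fin_succ, h, h.symm, hyz, hyz.symm, hxy, hxy.symm, hxz, hxz.symm, hxy',
      hxy'.symm, hxz', hxz'.symm]
  · have h' : ¬ G.Adj x' x := fun e => h e.symm
    refine hD ⟨⟨⟨_, hinj⟩, ?_⟩⟩
    simp [diamond, Fin.forall_fin_succ, h, h', hyz, hyz.symm, hxy, hxy.symm, hxz, hxz.symm, hxy',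
      hxy'.symm, hxz', hxz'.symm]

theorem adj_of_adj_triangle (hD : IndFree diamond G) (hB : IndFree bull G) (hK : IndFree K4 G)
    {a b c x y : V} (hab : G.Adj a b) (hbc : G.Adj b c) (hac : G.Adj a c) (hxa : G.Adj x a)
    (hxb : x ≠ b) (hxc : x ≠ c) (hyb : G.Adj y b) (hya : y ≠ a) (hyc : y ≠ c) : G.Adj x y := by
  by_contra hxy
  have nxb : ¬ G.Adj x b := fun h =>
    hxc (eq_of_common_adj_adj hD hK hab hxa h hac.symm hbc.symm)
  have nxc : ¬ G.Adj x c := fun h =>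
    hxb (eq_of_common_adj_adj hD hK hac hxa h hab.symm hbc)
  have nya : ¬ G.Adj y a := fun h =>
    hyc (eq_of_common_adj_adj hD hK hab h hyb hac.symm hbc.symm)
  have nyc : ¬ G.Adj y c := fun h =>
    hya (eq_of_common_adj_adj hD hK hbc hyb h hab hac)
  have hne : x ≠ y := fun h => nxb (h ▸ hyb)
  have hinj : Function.Injective ![x, a, b, y, c] := by
    simp [Function.Injective, Fin.forall_fin_succ, hab.ne, hab.ne', hbc.ne, hbc.ne', hac.ne,
      hac.ne', hxa.ne, hxa.ne', hyb.ne, hyb.ne', hxb, hxb.symm, hxc, hxc.symm, hya, hya.symm, hyc,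
      hyc.symm, hne, hne.symm]
  refine hB ⟨⟨⟨_, hinj⟩, ?_⟩⟩
  simp [bull, Fin.forall_fin_succ, hab, hab.symm, hbc, hbc.symm, hac, hac.symm, hxa, hxa.symm, hyb,
    hyb.symm, hxy, mt G.adj_symm hxy, nxb, mt G.adj_symm nxb, nxc, mt G.adj_symm nxc,
    nya, mt G.adj_symm nya, nyc, mt G.adj_symm nyc]

open Classical in
/-- Every triangle has a vertex of degree at most 3. -/
theorem exists_degree_lt_four_of_triangle [Fintype V] (hD : IndFree diamond G)
    (hB : IndFree bull G) (hK : IndFree K4 G) {a b c : V} (hab : G.Adj a b) (hbc : G.Adj b c)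
    (hac : G.Adj a c) : ∃ v, G.degree v < 4 := by
  by_contra! hdeg
  have two : ∀ v p q : V, ∃ x x', x ≠ x' ∧ (G.Adj x v ∧ x ≠ p ∧ x ≠ q) ∧
      G.Adj x' v ∧ x' ≠ p ∧ x' ≠ q := by
    intro v p q
    have hcard : 1 < (G.neighborFinset v \ {p, q}).card := by
      have h₁ := Finset.le_card_sdiff {p, q} (G.neighborFinset v)
      have h₂ := Finset.card_le_two (a := p) (b := q)
      have h₃ := hdeg v
      rw [← card_neighborFinset_eq_degree] at h₃
      omega
    obtain ⟨x, hx, x', hx', hne⟩ := Finset.one_lt_card.1 hcard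
    simp only [Finset.mem_sdiff, mem_neighborFinset, Finset.mem_insert, Finset.mem_singleton,
      not_or] at hx hx'
    exact ⟨x, x', hne, ⟨hx.1.symm, hx.2⟩, hx'.1.symm, hx'.2⟩
  obtain ⟨x, x', hne, ⟨hx, hxb, hxc⟩, hx', hxb', hxc'⟩ := two a b c
  obtain ⟨y, -, -, ⟨hy, hya, hyc⟩, -⟩ := two b a c
  obtain ⟨z, -, -, ⟨hz, hza, hzb⟩, -⟩ := two c a b
  exact hne (eq_of_common_adj_adj hD hK
    (adj_of_adj_triangle hD hB hK hbc hac.symm hab.symm hy hyc hya hz hzb hza)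
    (adj_of_adj_triangle hD hB hK hab hbc hac hx hxb hxc hy hya hyc)
    (adj_of_adj_triangle hD hB hK hac hbc.symm hab hx hxc hxb hz hza hzb)
    (adj_of_adj_triangle hD hB hK hab hbc hac hx' hxb' hxc' hy hya hyc)
    (adj_of_adj_triangle hD hB hK hac hbc.symm hab hx' hxc' hxb' hz hza hzb))

end Forbidden

/-- Every (P6, diamond, bull, K4)-free graph is 4-colorable. -/
theorem stmt3 {V : Type*} [Fintype V] (G : SimpleGraph V)
    (hP : IndFree (pathGraph 6) G) (hD : IndFree diamond G)
    (hB : IndFree bull G) (hK : IndFree K4 G) :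
    G.Colorable 4 := by
  classical
  induction hn : Fintype.card V using Nat.strong_induction_on generalizing V with
  | _ n ih =>
  by_cases hG : G.CliqueFree 3
  · exact by_contra fun hcol => hP (hG.exists_inducedPath hcol)
  · simp only [CliqueFree, not_forall, not_not] at hG
    obtain ⟨s, hs⟩ := hG
    obtain ⟨a, b, c, hab, hac, hbc, -⟩ := is3Clique_iff.1 hs
    obtain ⟨v, hv⟩ := exists_degree_lt_four_of_triangle hD hB hK hab hbc hac
    exact Colorable.of_induce_compl_singleton hv
      (ih _ (hn ▸ Fintype.card_subtype_lt (x := v) (by simp)) _ (hP.induce _) (hD.induce _)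
        (hB.induce _) (hK.induce _) rfl)
end

section
/- Let G be a connected graph that is (P2 ∪ P3)-free, diamond-free and K4-free, and let T be a triangle in G. Then every vertex of G is at distance at most 2 from T; that is, for every vertex y of G there is a vertex of T at graph distance at most 2 from y. -/
open SimpleGraph

section

variable {V : Type*} {G : SimpleGraph V}

/-- A map that preserves and reflects adjacency, and is injective, is an induced copy. -/
theorem IndFree.false_of_adj_iff {α : Type*} {H : SimpleGraph α} (h : IndFree H G) (f : α → V)
    (hf : Function.Injective f) (hadj : ∀ i j, G.Adj (f i) (f j) ↔ H.Adj i j) : False :=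
  h ⟨⟨⟨f, hf⟩, hadj _ _⟩⟩

/-- In a graph without diamonds and `K4`s, a vertex outside a triangle that is adjacent to one
of its vertices is not adjacent to another. -/
theorem not_adj_of_adj_triangle (hD : IndFree diamond G) (hK : IndFree K4 G) {a b c x : V}
    (hab : G.Adj a b) (hac : G.Adj a c) (hbc : G.Adj b c) (hxc : x ≠ c) (hxa : G.Adj x a) :
    ¬ G.Adj x b := by
  intro hxb
  have := hab.ne
  have := hac.ne
  have := hbc.ne
  have := hxa.ne
  have := hxb.ne
  have hinj : Function.Injective ![x, a, c, b] := by
    intro i j hij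
    fin_cases i <;> fin_cases j <;> simp_all [eq_comm]
  by_cases hx : G.Adj x c
  · refine hK.false_of_adj_iff ![x, a, c, b] hinj fun i j => ?_
    fin_cases i <;> fin_cases j <;> simp_all [K4, G.adj_comm]
  · refine hD.false_of_adj_iff ![x, a, c, b] hinj fun i j => ?_
    fin_cases i <;> fin_cases j <;> simp_all [diamond, G.adj_comm]

/-- In a `P2 ∪ P3`-free graph, an edge `bc` and an induced path `xvw` cannot be
anticomplete to each other. -/
theorem false_of_edge_path (hP : IndFree p2p3 G) {b c x v w : V}
    (hbc : G.Adj b c) (hxv : G.Adj x v) (hvw : G.Adj v w) (hxw : ¬ G.Adj x w) (hne : x ≠ w)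
    (hxb : ¬ G.Adj x b) (hxc : ¬ G.Adj x c) (hvb : ¬ G.Adj v b) (hvc : ¬ G.Adj v c)
    (hwb : ¬ G.Adj w b) (hwc : ¬ G.Adj w c) : False := by
  have := hbc.ne
  have := hxv.ne
  have := hvw.ne
  have : x ≠ b := by rintro rfl; exact hxc hbc
  have : x ≠ c := by rintro rfl; exact hxb hbc.symm
  have : v ≠ b := by rintro rfl; exact hvc hbc
  have : v ≠ c := by rintro rfl; exact hvb hbc.symm
  have : w ≠ b := by rintro rfl; exact hwc hbc
  have : w ≠ c := by rintro rfl; exact hwb hbc.symm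
  refine hP.false_of_adj_iff ![b, c, x, v, w] ?_ fun i j => ?_
  · intro i j hij
    fin_cases i <;> fin_cases j <;> simp_all [eq_comm]
  · fin_cases i <;> fin_cases j <;> simp_all [p2p3, G.adj_comm]

/-- `y` is joined to `t` by a walk of length at most two. -/
def WithinTwo (G : SimpleGraph V) (y t : V) : Prop :=
  y = t ∨ G.Adj y t ∨ ∃ x, G.Adj y x ∧ G.Adj x t

theorem WithinTwo.dist_le {y t : V} (h : WithinTwo G y t) : G.dist y t ≤ 2 := by
  rcases h with rfl | h | ⟨x, h, h'⟩
  · simp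
  · exact (SimpleGraph.dist_le h.toWalk).trans (by simp)
  · exact (SimpleGraph.dist_le (.cons h h'.toWalk)).trans (by simp)

/-- Being within distance two of a triangle passes to neighbours, if the walk from the known
vertex ends in `a`. -/
theorem withinTwo_triangle_of_adj (hP : IndFree p2p3 G) (hD : IndFree diamond G)
    (hK : IndFree K4 G) {a b c v w : V} (hab : G.Adj a b) (hac : G.Adj a c) (hbc : G.Adj b c)
    (hwv : G.Adj w v) (hv : WithinTwo G v a) :
    WithinTwo G w a ∨ WithinTwo G w b ∨ WithinTwo G w c := by
  by_contra! hfar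
  obtain ⟨ha, hb, hc⟩ := hfar
  simp only [WithinTwo, not_or, not_exists, not_and] at ha hb hc
  rcases hv with rfl | hva | ⟨x, hvx, hxa⟩
  · exact ha.2.1 hwv
  · exact ha.2.2 v hwv hva
  · have hvb := hb.2.2 v hwv
    have hvc := hc.2.2 v hwv
    have hxb : x ≠ b := by rintro rfl; exact hvb hvx
    have hxc : x ≠ c := by rintro rfl; exact hvc hvx
    refine false_of_edge_path hP hbc hvx.symm hwv.symm (fun h => ha.2.2 x h.symm hxa) ?_
      (not_adj_of_adj_triangle hD hK hab hac hbc hxc hxa)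
      (not_adj_of_adj_triangle hD hK hac hab hbc.symm hxb hxa) hvb hvc hb.2.1 hc.2.1
    rintro rfl
    exact ha.2.1 hxa

end

/-- In a connected (P2 ∪ P3, diamond, K4)-free graph, every vertex is at
distance at most 2 from any triangle. -/
theorem stmt11 {V : Type*} [Fintype V] (G : SimpleGraph V)
    (hconn : G.Connected)
    (hP : IndFree p2p3 G) (hD : IndFree diamond G) (hK : IndFree K4 G)
    (a b c : V) (hab : G.Adj a b) (hac : G.Adj a c) (hbc : G.Adj b c) :
    ∀ y : V, ∃ t ∈ ({a, b, c} : Set V), G.dist y t ≤ 2 := by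
  intro y
  suffices h : WithinTwo G y a ∨ WithinTwo G y b ∨ WithinTwo G y c by
    rcases h with h | h | h
    · exact ⟨a, by simp, h.dist_le⟩
    · exact ⟨b, by simp, h.dist_le⟩
    · exact ⟨c, by simp, h.dist_le⟩
  have key : ∀ {u z : V}, G.Walk u z → z = a →
      WithinTwo G u a ∨ WithinTwo G u b ∨ WithinTwo G u c := by
    intro u z p hz
    induction p with
    | nil => exact .inl (.inl hz)
    | cons hwv _ ih =>
      rcases ih hz with h | h | h
      · exact withinTwo_triangle_of_adj hP hD hK hab hac hbc hwv h
      · have := withinTwo_triangle_of_adj hP hD hK hab.symm hbc hac hwv h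
        tauto
      · have := withinTwo_triangle_of_adj hP hD hK hac.symm hbc.symm hab hwv h
        tauto
  obtain ⟨p⟩ := hconn.preconnected y a
  exact key p rfl
end

section
/- Let G be a diamond-free and bull-free graph containing an induced 5-cycle C with vertices v1, v2, v3, v4, v5 (edges v1v2, v2v3, v3v4, v4v5, v5v1). Then every vertex x of G not on C that has a neighbor on C satisfies: the set of neighbors of x on C is either a single vertex, or a pair of non-adjacent vertices of C. -/
open SimpleGraph

theorem IndFree.false_of_diamond {V : Type*} {G : SimpleGraph V} (hD : IndFree diamond G)
    {a b c d : V} (hab : G.Adj a b) (hbc : G.Adj b c) (hcd : G.Adj c d) (had : G.Adj a d)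
    (hbd : G.Adj b d) (hac : ¬ G.Adj a c) (hne : a ≠ c) : False := by
  refine hD ⟨⟨⟨![a, b, c, d], ?_⟩, ?_⟩⟩
  · intro i j hij
    have := hab.ne
    have := hbc.ne
    have := hcd.ne
    have := had.ne
    have := hbd.ne
    fin_cases i <;> fin_cases j <;> simp_all
  · intro i j
    change G.Adj (![a, b, c, d] i) (![a, b, c, d] j) ↔ _
    fin_cases i <;> fin_cases j <;> simp_all [diamond, G.adj_comm]

theorem IndFree.false_of_bull {V : Type*} {G : SimpleGraph V} (hB : IndFree bull G)
    {a b c d e : V} (hab : G.Adj a b) (hbc : G.Adj b c) (hcd : G.Adj c d) (hbe : G.Adj b e)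
    (hce : G.Adj c e) (hac : ¬ G.Adj a c) (had : ¬ G.Adj a d) (hae : ¬ G.Adj a e)
    (hbd : ¬ G.Adj b d) (hde : ¬ G.Adj d e) : False := by
  refine hB ⟨⟨⟨![a, b, c, d, e], ?_⟩, ?_⟩⟩
  · intro i j hij
    fin_cases i <;> fin_cases j <;> simp_all [G.adj_comm]
  · intro i j
    change G.Adj (![a, b, c, d, e] i) (![a, b, c, d, e] j) ↔ _
    fin_cases i <;> fin_cases j <;> simp_all [bull, G.adj_comm]

/-- In a (diamond, bull)-free graph, no vertex off an induced 5-cycle sees two consecutive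
vertices of the cycle. -/
theorem not_adj_consecutive {V : Type*} {G : SimpleGraph V}
    (hD : IndFree diamond G) (hB : IndFree bull G)
    {v : Fin 5 → V} (hinj : Function.Injective v)
    (hC : ∀ i j : Fin 5, G.Adj (v i) (v j) ↔ (j = i + 1 ∨ i = j + 1))
    {x : V} {i : Fin 5} (hi : G.Adj x (v i)) :
    ¬ G.Adj x (v (i + 1)) := by
  intro hj
  have h₁ : G.Adj (v (i + 4)) (v i) := (hC _ _).2 (by clear * -; decide +revert)
  have h₂ : G.Adj (v i) (v (i + 1)) := (hC _ _).2 (by clear * -; decide +revert)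
  have h₃ : G.Adj (v (i + 1)) (v (i + 2)) := (hC _ _).2 (by clear * -; decide +revert)
  have h₄ : ¬ G.Adj (v (i + 4)) (v (i + 1)) := fun h =>
    absurd ((hC _ _).1 h) (by clear * -; decide +revert)
  have h₅ : ¬ G.Adj (v (i + 4)) (v (i + 2)) := fun h =>
    absurd ((hC _ _).1 h) (by clear * -; decide +revert)
  have h₆ : ¬ G.Adj (v i) (v (i + 2)) := fun h =>
    absurd ((hC _ _).1 h) (by clear * -; decide +revert)
  have h₇ : ¬ G.Adj (v (i + 4)) x := fun h =>
    hD.false_of_diamond h₁ h₂ hj.symm h hi.symm h₄ (hinj.ne (by clear * -; decide +revert))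
  have h₈ : ¬ G.Adj (v (i + 2)) x := fun h =>
    hD.false_of_diamond h₂ h₃ h hi.symm hj.symm h₆ (hinj.ne (by clear * -; decide +revert))
  exact hB.false_of_bull h₁ h₂ h₃ hi.symm hj.symm h₄ h₅ h₇ h₆ h₈

/-- In a (diamond, bull)-free graph with an induced 5-cycle v0...v4, every
outside vertex with a neighbor on the cycle sees either exactly one cycle
vertex, or exactly two non-adjacent cycle vertices. -/
theorem stmt13 {V : Type*} [Fintype V] (G : SimpleGraph V)
    (hD : IndFree diamond G) (hB : IndFree bull G)
    (v : Fin 5 → V) (hinj : Function.Injective v)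
    (hC : ∀ i j : Fin 5, G.Adj (v i) (v j) ↔ (j = i + 1 ∨ i = j + 1))
    (x : V) (hx : ∀ i, x ≠ v i) (hnb : ∃ i, G.Adj x (v i)) :
    (∃ i : Fin 5, {j : Fin 5 | G.Adj x (v j)} = {i}) ∨
    (∃ i j : Fin 5, i ≠ j ∧ ¬ G.Adj (v i) (v j) ∧
      {k : Fin 5 | G.Adj x (v k)} = {i, j}) := by
  have key : ∀ i, G.Adj x (v i) → ¬ G.Adj x (v (i + 1)) :=
    fun i hi => not_adj_consecutive hD hB hinj hC hi
  obtain ⟨i, hi⟩ := hnb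
  by_cases h : ∃ j, j ≠ i ∧ G.Adj x (v j)
  · obtain ⟨j, hji, hj⟩ := h
    have hij : ¬ (j = i + 1 ∨ i = j + 1) := by
      rintro (rfl | rfl)
      · exact key _ hi hj
      · exact key _ hj hi
    refine Or.inr ⟨i, j, hji.symm, fun hadj => hij ((hC i j).1 hadj), ?_⟩
    ext k
    simp only [Set.mem_ofPred_eq, Set.mem_insert_iff, Set.mem_singleton_iff]
    constructor
    · intro hk
      have hik : ¬ (k = i + 1 ∨ i = k + 1) := by
        rintro (rfl | rfl)
        · exact key _ hi hk
        · exact key _ hk hi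
      have hjk : ¬ (k = j + 1 ∨ j = k + 1) := by
        rintro (rfl | rfl)
        · exact key _ hj hk
        · exact key _ hk hj
      clear * - hji hij hik hjk
      decide +revert
    · rintro (rfl | rfl) <;> assumption
  · push Not at h
    refine Or.inl ⟨i, ?_⟩
    ext k
    simp only [Set.mem_ofPred_eq, Set.mem_singleton_iff]
    exact ⟨fun hk => by_contra fun hne => h k hne hk, fun hk => hk ▸ hi⟩
end
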